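/- arXiv:1603.00280 — 3 statements merged into one kernel-verified Lean document; each statement's English description precedes it below -/
import Mathlib

section
/- Let (X,d) be a proper Polish length metric space and (ι_t)_{t≥0} a family of maps ι_t : X → 𝒫₂(X) such that: ι_0(x) = δ_x for all x ∈ X; each ι_t is injective; there are constants C_t > 0 with W(ι_t(x), ι_t(y)) ≤ C_t·d(x,y) for all x,y ∈ X and with t ↦ C_t locally bounded from above; and for each x ∈ X the curve t ↦ ι_t(x) is W-continuous. Fix t ≥ 0, set d̃_t(x,y) := W(ι_t(x), ι_t(y)) and let d_t be the length distance induced by d̃_t. Assume in addition that every d̃_t-bounded subset of X is d-bounded. Then d̃_t and d_t induce the same topology on X as d; i.e. for every sequence (xₙ) and point x in X one has d(xₙ,x) → 0 if and only if d̃_t(xₙ,x) → 0, if and only if d_t(xₙ,x) → 0. -/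
open MeasureTheory ENNReal

/-- A coupling of two measures: a measure on the product whose marginals are the two
given measures. -/
def IsCoupling {Y : Type*} [MeasurableSpace Y] (π : Measure (Y × Y)) (μ ν : Measure Y) : Prop :=
  π.map Prod.fst = μ ∧ π.map Prod.snd = ν

/-- The (squared) optimal transport cost for the quadratic cost built from `c`. -/
noncomputable def transportCost {Y : Type*} [MeasurableSpace Y] (c : Y → Y → ℝ)
    (μ ν : Measure Y) : ℝ≥0∞ :=
  ⨅ (π : Measure (Y × Y)) (_ : IsCoupling π μ ν), ∫⁻ p, ENNReal.ofReal (c p.1 p.2 ^ 2) ∂π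

/-- The `L²`-Wasserstein distance associated to the cost `c`. -/
noncomputable def W2 {Y : Type*} [MeasurableSpace Y] (c : Y → Y → ℝ) (μ ν : Measure Y) : ℝ :=
  Real.sqrt (transportCost c μ ν).toReal

/-- A measure on a metric space has finite second moment. -/
def HasFiniteSecondMoment {X : Type*} [MetricSpace X] [MeasurableSpace X] (μ : Measure X) :
    Prop :=
  ∃ x₀ : X, ∫⁻ x, ENNReal.ofReal (dist x₀ x ^ 2) ∂μ < ⊤

/-- A partition `0 = s 0 < s 1 < ⋯ < s N = 1` of `[0,1]`. -/
def IsPartition (N : ℕ) (s : ℕ → ℝ) : Prop :=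
  s 0 = 0 ∧ s N = 1 ∧ ∀ i < N, s i < s (i + 1)

/-- The length of the curve `γ : [0,1] → Y` with respect to the distance `ρ`, as the
supremum over partitions of sums of consecutive `ρ`-distances. -/
noncomputable def curveLength {Y : Type*} (ρ : Y → Y → ℝ) (γ : ℝ → Y) : ℝ≥0∞ :=
  ⨆ (N : ℕ) (s : ℕ → ℝ) (_ : IsPartition N s),
    ENNReal.ofReal (∑ i ∈ Finset.range N, ρ (γ (s i)) (γ (s (i + 1))))

/-- Continuity of a curve `γ : [0,1] → Y` with respect to the distance `ρ`. -/
def RhoContinuousCurve {Y : Type*} (ρ : Y → Y → ℝ) (γ : ℝ → Y) : Prop :=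
  ∀ s ∈ Set.Icc (0:ℝ) 1, ∀ ε > 0, ∃ δ > 0, ∀ s' ∈ Set.Icc (0:ℝ) 1,
    |s' - s| < δ → ρ (γ s) (γ s') < ε

/-- The length distance induced by the distance `ρ`. -/
noncomputable def lengthDist {Y : Type*} (ρ : Y → Y → ℝ) (x y : Y) : ℝ≥0∞ :=
  ⨅ (γ : ℝ → Y) (_ : RhoContinuousCurve ρ γ ∧ γ 0 = x ∧ γ 1 = y), curveLength ρ γ

/-- A metric space is a length space: the distance coincides with the induced length
distance. -/
def IsLengthSpace (X : Type*) [MetricSpace X] : Prop :=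
  ∀ x y : X, lengthDist (fun a b => dist a b) x y = ENNReal.ofReal (dist x y)

open Filter Topology

section LengthDist

variable {Y : Type*} {ρ σ : Y → Y → ℝ}

theorem ofReal_le_lengthDist (ρ : Y → Y → ℝ) (x y : Y) :
    ENNReal.ofReal (ρ x y) ≤ lengthDist ρ x y := by
  refine le_iInf₂ fun γ hγ ↦ ?_
  have hs : IsPartition 1 (fun i ↦ (i : ℝ)) := ⟨by simp, by simp, fun i _ ↦ by simp⟩
  refine le_trans ?_ (le_iSup₂_of_le 1 (fun i ↦ (i : ℝ)) (le_iSup_of_le hs le_rfl))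
  simp [hγ.2.1, hγ.2.2]

theorem RhoContinuousCurve.of_le_mul {K : ℝ} (hK : 0 < K) (h : ∀ x y, σ x y ≤ K * ρ x y)
    {γ : ℝ → Y} (hγ : RhoContinuousCurve ρ γ) : RhoContinuousCurve σ γ := by
  intro s hs ε hε
  obtain ⟨δ, hδ, H⟩ := hγ s hs (ε / K) (div_pos hε hK)
  refine ⟨δ, hδ, fun s' hs' hd ↦ (h _ _).trans_lt ?_⟩
  have := (lt_div_iff₀ hK).1 (H s' hs' hd)
  linarith

theorem curveLength_le_mul {K : ℝ} (hK : 0 < K) (h : ∀ x y, σ x y ≤ K * ρ x y) (γ : ℝ → Y) :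
    curveLength σ γ ≤ ENNReal.ofReal K * curveLength ρ γ := by
  refine iSup₂_le fun N s ↦ iSup_le fun hs ↦ ?_
  calc ENNReal.ofReal (∑ i ∈ Finset.range N, σ (γ (s i)) (γ (s (i + 1))))
      ≤ ENNReal.ofReal (K * ∑ i ∈ Finset.range N, ρ (γ (s i)) (γ (s (i + 1)))) := by
        rw [Finset.mul_sum]
        exact ENNReal.ofReal_le_ofReal (Finset.sum_le_sum fun i _ ↦ h _ _)
    _ = ENNReal.ofReal K *
          ENNReal.ofReal (∑ i ∈ Finset.range N, ρ (γ (s i)) (γ (s (i + 1)))) :=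
        ENNReal.ofReal_mul hK.le
    _ ≤ _ := by
        gcongr
        exact le_iSup₂_of_le N s (le_iSup_of_le hs le_rfl)

theorem lengthDist_le_mul {K : ℝ} (hK : 0 < K) (h : ∀ x y, σ x y ≤ K * ρ x y) (x y : Y) :
    lengthDist σ x y ≤ ENNReal.ofReal K * lengthDist ρ x y := by
  have h0 : ENNReal.ofReal K ≠ 0 := by simpa using hK
  simp only [lengthDist, ENNReal.mul_iInf_of_ne h0 ENNReal.ofReal_ne_top]
  exact le_iInf₂ fun γ hγ ↦
    iInf₂_le_of_le γ ⟨hγ.1.of_le_mul hK h, hγ.2⟩ (curveLength_le_mul hK h γ)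

end LengthDist

section Transport

theorem ofReal_dist_sq_le {X : Type*} [PseudoMetricSpace X] (x y z : X) :
    ENNReal.ofReal (dist x z ^ 2) ≤
      2 * ENNReal.ofReal (dist y x ^ 2) + 2 * ENNReal.ofReal (dist y z ^ 2) := by
  have h2 : (2 : ℝ≥0∞) = ENNReal.ofReal 2 := by simp
  rw [h2, ← ENNReal.ofReal_mul zero_le_two, ← ENNReal.ofReal_mul zero_le_two,
    ← ENNReal.ofReal_add (by positivity) (by positivity)]
  apply ENNReal.ofReal_le_ofReal
  have := dist_triangle_left x z y
  nlinarith [sq_nonneg (dist y x - dist y z), dist_nonneg (x := x) (y := z)]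

theorem measurable_ofReal_dist_sq {X : Type*} [PseudoMetricSpace X] [MeasurableSpace X]
    [OpensMeasurableSpace X] (o : X) : Measurable fun x ↦ ENNReal.ofReal (dist o x ^ 2) :=
  (ENNReal.continuous_ofReal.comp (by fun_prop)).measurable

variable {X : Type*} [MetricSpace X] [MeasurableSpace X] [BorelSpace X]

theorem HasFiniteSecondMoment.lintegral_lt_top {μ : Measure X} [IsFiniteMeasure μ]
    (h : HasFiniteSecondMoment μ) (o : X) : ∫⁻ x, ENNReal.ofReal (dist o x ^ 2) ∂μ < ⊤ := by
  obtain ⟨z, hz⟩ := h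
  refine (lintegral_mono fun x ↦ ofReal_dist_sq_le o z x).trans_lt ?_
  rw [lintegral_add_left measurable_const, lintegral_const,
    lintegral_const_mul _ (measurable_ofReal_dist_sq z)]
  exact ENNReal.add_lt_top.2 ⟨ENNReal.mul_lt_top (by finiteness) (measure_lt_top _ _),
    ENNReal.mul_lt_top (by finiteness) hz⟩

theorem eq_of_levyProkhorovDist_eq_zero {μ ν : Measure X} [IsProbabilityMeasure μ]
    [IsProbabilityMeasure ν] (h : levyProkhorovDist μ ν = 0) : μ = ν := by
  let P : ProbabilityMeasure X := ⟨μ, ‹_›⟩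
  let Q : ProbabilityMeasure X := ⟨ν, ‹_›⟩
  have hPQ : LevyProkhorov.ofMeasure P = LevyProkhorov.ofMeasure Q := eq_of_dist_eq_zero h
  exact congrArg (fun R ↦ (R.toMeasure : Measure X)) hPQ

variable [TopologicalSpace.SeparableSpace X]

theorem measurable_ofReal_dist_sq_prod :
    Measurable fun p : X × X ↦ ENNReal.ofReal (dist p.1 p.2 ^ 2) :=
  have := UniformSpace.secondCountable_of_separable X
  (ENNReal.continuous_ofReal.comp (by fun_prop)).measurable

theorem transportCost_le_secondMoment (μ ν : Measure X) [IsProbabilityMeasure μ]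
    [IsProbabilityMeasure ν] (o : X) :
    transportCost (fun a b : X ↦ dist a b) μ ν ≤
      2 * ∫⁻ x, ENNReal.ofReal (dist o x ^ 2) ∂μ +
        2 * ∫⁻ x, ENNReal.ofReal (dist o x ^ 2) ∂ν := by
  have hc : IsCoupling (μ.prod ν) μ ν := ⟨by simp, by simp⟩
  have hm := measurable_ofReal_dist_sq o
  have hm₁ : Measurable fun p : X × X ↦ ENNReal.ofReal (dist o p.1 ^ 2) := hm.comp measurable_fst
  have hm₂ : Measurable fun p : X × X ↦ ENNReal.ofReal (dist o p.2 ^ 2) := hm.comp measurable_snd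
  calc transportCost (fun a b : X ↦ dist a b) μ ν
      ≤ ∫⁻ p, ENNReal.ofReal (dist p.1 p.2 ^ 2) ∂(μ.prod ν) := iInf₂_le (μ.prod ν) hc
    _ ≤ ∫⁻ p, (2 * ENNReal.ofReal (dist o p.1 ^ 2) + 2 * ENNReal.ofReal (dist o p.2 ^ 2))
          ∂(μ.prod ν) := lintegral_mono fun p ↦ ofReal_dist_sq_le p.1 o p.2
    _ = 2 * ∫⁻ p, ENNReal.ofReal (dist o p.1 ^ 2) ∂(μ.prod ν) +
          2 * ∫⁻ p, ENNReal.ofReal (dist o p.2 ^ 2) ∂(μ.prod ν) := by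
        rw [lintegral_add_left (hm₁.const_mul 2),
          lintegral_const_mul 2 hm₁,
          lintegral_const_mul 2 hm₂]
    _ = 2 * ∫⁻ x, ENNReal.ofReal (dist o x ^ 2) ∂((μ.prod ν).map Prod.fst) +
          2 * ∫⁻ x, ENNReal.ofReal (dist o x ^ 2) ∂((μ.prod ν).map Prod.snd) := by
        rw [lintegral_map hm measurable_fst, lintegral_map hm measurable_snd]
    _ = _ := by rw [hc.1, hc.2]

theorem secondMoment_le_transportCost (μ ν : Measure X) (o : X) :
    ∫⁻ x, ENNReal.ofReal (dist o x ^ 2) ∂μ ≤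
      2 * transportCost (fun a b : X ↦ dist a b) μ ν +
        2 * ∫⁻ x, ENNReal.ofReal (dist o x ^ 2) ∂ν := by
  have hm := measurable_ofReal_dist_sq o
  have hm₂ : Measurable fun p : X × X ↦ ENNReal.ofReal (dist o p.2 ^ 2) := hm.comp measurable_snd
  simp only [transportCost, ENNReal.mul_iInf_of_ne two_ne_zero ENNReal.ofNat_ne_top,
    ENNReal.iInf_add]
  refine le_iInf₂ fun π hπ ↦ ?_
  calc ∫⁻ x, ENNReal.ofReal (dist o x ^ 2) ∂μ
      = ∫⁻ p, ENNReal.ofReal (dist o p.1 ^ 2) ∂π := by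
        rw [← hπ.1, lintegral_map hm measurable_fst]
    _ ≤ ∫⁻ p, (2 * ENNReal.ofReal (dist p.1 p.2 ^ 2) + 2 * ENNReal.ofReal (dist o p.2 ^ 2))
          ∂π := lintegral_mono fun p ↦ by
        rw [add_comm, dist_comm p.1 p.2, dist_comm o p.2]
        exact ofReal_dist_sq_le o p.2 p.1
    _ = 2 * ∫⁻ p, ENNReal.ofReal (dist p.1 p.2 ^ 2) ∂π +
          2 * ∫⁻ p, ENNReal.ofReal (dist o p.2 ^ 2) ∂π := by
        rw [lintegral_add_left (measurable_ofReal_dist_sq_prod.const_mul 2),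
          lintegral_const_mul 2 measurable_ofReal_dist_sq_prod,
          lintegral_const_mul 2 hm₂]
    _ = _ := by rw [← hπ.2, lintegral_map hm measurable_snd]

theorem transportCost_eq_ofReal_W2_sq {μ ν : Measure X} [IsProbabilityMeasure μ]
    [IsProbabilityMeasure ν] (hμ : HasFiniteSecondMoment μ) (hν : HasFiniteSecondMoment ν) :
    transportCost (fun a b : X ↦ dist a b) μ ν =
      ENNReal.ofReal (W2 (fun a b : X ↦ dist a b) μ ν ^ 2) := by
  obtain ⟨o, ho⟩ := hμ
  have hlt : transportCost (fun a b : X ↦ dist a b) μ ν < ⊤ :=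
    (transportCost_le_secondMoment μ ν o).trans_lt <| ENNReal.add_lt_top.2
      ⟨ENNReal.mul_lt_top (by finiteness) ho,
        ENNReal.mul_lt_top (by finiteness) (hν.lintegral_lt_top o)⟩
  rw [W2, Real.sq_sqrt ENNReal.toReal_nonneg, ENNReal.ofReal_toReal hlt.ne]

theorem levyProkhorovDist_le_of_transportCost_lt {μ ν : Measure X} [IsProbabilityMeasure μ]
    [IsProbabilityMeasure ν] {δ : ℝ} (hδ : 0 < δ)
    (h : transportCost (fun a b : X ↦ dist a b) μ ν < ENNReal.ofReal (δ ^ 3)) :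
    levyProkhorovDist μ ν ≤ δ := by
  simp only [transportCost, iInf_lt_iff] at h
  obtain ⟨π, ⟨rfl, rfl⟩, hlt⟩ := h
  refine levyProkhorovDist_le_of_forall_le _ _ hδ.le fun ε B hε hB ↦ ?_
  have hε0 : 0 < ε := hδ.trans hε
  rw [Measure.map_apply measurable_fst hB,
    Measure.map_apply measurable_snd Metric.isOpen_thickening.measurableSet]
  have hmarkov : π {p | ENNReal.ofReal (ε ^ 2) ≤ ENNReal.ofReal (dist p.1 p.2 ^ 2)} ≤
      ENNReal.ofReal ε := by
    have h0 : ENNReal.ofReal (ε ^ 2) ≠ 0 := by simpa using hε0.ne'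
    refine (ENNReal.mul_le_mul_iff_right h0 ENNReal.ofReal_ne_top).1 ?_
    rw [← ENNReal.ofReal_mul (by positivity)]
    refine (mul_meas_ge_le_lintegral measurable_ofReal_dist_sq_prod _).trans (hlt.le.trans ?_)
    rw [← pow_succ]
    gcongr
  refine le_trans ((measure_mono fun p hp ↦ ?_).trans (measure_union_le _ _))
    (add_le_add le_rfl hmarkov)
  by_cases hd : dist p.1 p.2 < ε
  · exact .inl (Metric.mem_thickening_iff.2 ⟨p.1, hp, by rwa [dist_comm]⟩)
  · refine .inr (ENNReal.ofReal_le_ofReal ?_)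
    have := not_lt.1 hd
    gcongr

theorem tendsto_levyProkhorovDist_of_W2 {μ : ℕ → Measure X} {ν : Measure X}
    [∀ n, IsProbabilityMeasure (μ n)] [IsProbabilityMeasure ν]
    (hμ : ∀ n, HasFiniteSecondMoment (μ n)) (hν : HasFiniteSecondMoment ν)
    (h : Tendsto (fun n ↦ W2 (fun a b : X ↦ dist a b) (μ n) ν) atTop (𝓝 0)) :
    Tendsto (fun n ↦ levyProkhorovDist (μ n) ν) atTop (𝓝 0) := by
  refine tendsto_order.2 ⟨fun a ha ↦ .of_forall fun n ↦ ha.trans_le ENNReal.toReal_nonneg,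
    fun a ha ↦ ?_⟩
  have h2 := h.pow 2
  rw [zero_pow two_ne_zero] at h2
  filter_upwards [h2.eventually_lt_const (show (0 : ℝ) < (a / 2) ^ 3 by positivity)] with n hn
  refine (levyProkhorovDist_le_of_transportCost_lt (half_pos ha) ?_).trans_lt (half_lt_self ha)
  rw [transportCost_eq_ofReal_W2_sq (hμ n) hν]
  exact (ENNReal.ofReal_lt_ofReal_iff (by positivity)).2 hn

theorem eq_of_tendsto_W2 {μ : ℕ → Measure X} {ν κ : Measure X}
    [∀ n, IsProbabilityMeasure (μ n)] [IsProbabilityMeasure ν] [IsProbabilityMeasure κ]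
    (hμ : ∀ n, HasFiniteSecondMoment (μ n)) (hν : HasFiniteSecondMoment ν)
    (hκ : HasFiniteSecondMoment κ)
    (h₁ : Tendsto (fun n ↦ W2 (fun a b : X ↦ dist a b) (μ n) ν) atTop (𝓝 0))
    (h₂ : Tendsto (fun n ↦ W2 (fun a b : X ↦ dist a b) (μ n) κ) atTop (𝓝 0)) : ν = κ := by
  have key := (tendsto_levyProkhorovDist_of_W2 hμ hν h₁).add
    (tendsto_levyProkhorovDist_of_W2 hμ hκ h₂)
  rw [add_zero] at key
  refine eq_of_levyProkhorovDist_eq_zero (le_antisymm ?_ ENNReal.toReal_nonneg)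
  refine ge_of_tendsto' key fun n ↦ ?_
  rw [levyProkhorovDist_comm (μ n) ν]
  exact levyProkhorovDist_triangle _ _ _

theorem exists_forall_W2_le {μ : ℕ → Measure X} {ν : Measure X}
    [∀ n, IsProbabilityMeasure (μ n)] [IsProbabilityMeasure ν]
    (hμ : ∀ n, HasFiniteSecondMoment (μ n)) (hν : HasFiniteSecondMoment ν)
    {R : ℝ} (hR : ∀ n, W2 (fun a b : X ↦ dist a b) (μ n) ν ≤ R) :
    ∃ R', ∀ m n, W2 (fun a b : X ↦ dist a b) (μ m) (μ n) ≤ R' := by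
  obtain ⟨o, ho⟩ := hν
  obtain ⟨B, hB, hmom⟩ : ∃ B < ⊤, ∀ n, ∫⁻ x, ENNReal.ofReal (dist o x ^ 2) ∂(μ n) ≤ B := by
    refine ⟨2 * ENNReal.ofReal (R ^ 2) + 2 * ∫⁻ x, ENNReal.ofReal (dist o x ^ 2) ∂ν,
      ENNReal.add_lt_top.2 ⟨ENNReal.mul_lt_top (by finiteness) (by finiteness),
        ENNReal.mul_lt_top (by finiteness) ho⟩, fun n ↦ ?_⟩
    refine (secondMoment_le_transportCost (μ n) ν o).trans ?_
    rw [transportCost_eq_ofReal_W2_sq (hμ n) ⟨o, ho⟩]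
    have h0 : 0 ≤ W2 (fun a b : X ↦ dist a b) (μ n) ν := Real.sqrt_nonneg _
    have := hR n
    gcongr
  refine ⟨√((2 * B + 2 * B).toReal), fun m n ↦ Real.sqrt_le_sqrt (ENNReal.toReal_mono ?_ ?_)⟩
  · finiteness
  · refine (transportCost_le_secondMoment (μ m) (μ n) o).trans ?_
    exact add_le_add (by gcongr; exact hmom m) (by gcongr; exact hmom n)

end Transport

/-- for fixed `t ≥ 0`, if `d̃_t`-bounded sets are `d`-bounded, then `d̃_t`
and the induced length distance `d_t` define the same topology as `d`. -/
theorem stmt1 {X : Type*} [MetricSpace X] [MeasurableSpace X] [BorelSpace X]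
    [ProperSpace X] [CompleteSpace X] [TopologicalSpace.SeparableSpace X]
    (hlen : IsLengthSpace X)
    (ι : ℝ → X → Measure X)
    (hP2 : ∀ t ≥ (0:ℝ), ∀ x : X,
      IsProbabilityMeasure (ι t x) ∧ HasFiniteSecondMoment (ι t x))
    (hzero : ∀ x : X, ι 0 x = Measure.dirac x)
    (hinj : ∀ t ≥ (0:ℝ), Function.Injective (ι t))
    (C : ℝ → ℝ) (hCpos : ∀ t ≥ (0:ℝ), 0 < C t)
    (hLip : ∀ t ≥ (0:ℝ), ∀ x y : X,
      W2 (fun a b => dist a b) (ι t x) (ι t y) ≤ C t * dist x y)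
    (hCloc : ∀ T > (0:ℝ), ∃ M : ℝ, ∀ t' ∈ Set.Icc (0:ℝ) T, C t' ≤ M)
    (hcont : ∀ x : X, ∀ t' ≥ (0:ℝ), ∀ ε > (0:ℝ), ∃ δ > (0:ℝ), ∀ t'' ≥ (0:ℝ),
      |t'' - t'| < δ → W2 (fun a b => dist a b) (ι t' x) (ι t'' x) < ε)
    (t : ℝ) (ht : 0 ≤ t)
    -- every `d̃_t`-bounded set is `d`-bounded
    (hbdd : ∀ S : Set X,
      (∃ R : ℝ, ∀ x ∈ S, ∀ y ∈ S, W2 (fun a b => dist a b) (ι t x) (ι t y) ≤ R) →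
      ∃ R : ℝ, ∀ x ∈ S, ∀ y ∈ S, dist x y ≤ R) :
    ∀ (u : ℕ → X) (x : X),
      (Filter.Tendsto (fun n => dist (u n) x) Filter.atTop (nhds 0) ↔
        Filter.Tendsto (fun n => W2 (fun a b => dist a b) (ι t (u n)) (ι t x))
          Filter.atTop (nhds 0)) ∧
      (Filter.Tendsto (fun n => W2 (fun a b => dist a b) (ι t (u n)) (ι t x))
          Filter.atTop (nhds 0) ↔
        Filter.Tendsto
          (fun n => lengthDist (fun a b => W2 (fun a' b' => dist a' b') (ι t a) (ι t b))
            (u n) x)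
          Filter.atTop (nhds (0:ℝ≥0∞))) := by
  have hprob (y : X) : IsProbabilityMeasure (ι t y) := (hP2 t ht y).1
  have hmom (y : X) : HasFiniteSecondMoment (ι t y) := (hP2 t ht y).2
  have hW0 (y z : X) : 0 ≤ W2 (fun a b => dist a b) (ι t y) (ι t z) := Real.sqrt_nonneg _
  intro u x
  have forward (v : ℕ → X) (y : X) (h : Tendsto (fun n ↦ dist (v n) y) atTop (𝓝 0)) :
      Tendsto (fun n ↦ W2 (fun a b => dist a b) (ι t (v n)) (ι t y)) atTop (𝓝 0) :=
    squeeze_zero (fun n ↦ hW0 _ _) (fun n ↦ hLip t ht _ _) (by simpa using h.const_mul (C t))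
  have backward (h : Tendsto (fun n ↦ W2 (fun a b => dist a b) (ι t (u n)) (ι t x))
      atTop (𝓝 0)) : Tendsto (fun n ↦ dist (u n) x) atTop (𝓝 0) := by
    obtain ⟨R, hR⟩ := h.bddAbove_range
    obtain ⟨R', hR'⟩ := exists_forall_W2_le (fun n ↦ hmom (u n)) (hmom x)
      (fun n ↦ hR (Set.mem_range_self n))
    obtain ⟨D, hD⟩ := hbdd (Set.range u)
      ⟨R', by rintro _ ⟨m, rfl⟩ _ ⟨n, rfl⟩; exact hR' m n⟩
    have hbounded : Bornology.IsBounded (Set.range u) := Metric.isBounded_iff.2 ⟨D, hD⟩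
    refine tendsto_iff_dist_tendsto_zero.1 (tendsto_of_subseq_tendsto fun ns hns ↦ ?_)
    obtain ⟨y, -, ms, hms, hy⟩ :=
      tendsto_subseq_of_bounded hbounded (fun n ↦ Set.mem_range_self (ns n))
    have hyx : y = x := hinj t ht <| eq_of_tendsto_W2 (fun n ↦ hmom (u (ns (ms n)))) (hmom y)
      (hmom x) (forward _ y (tendsto_iff_dist_tendsto_zero.1 hy))
      (h.comp (hns.comp hms.tendsto_atTop))
    exact ⟨ms, hyx ▸ hy⟩
  refine ⟨⟨forward u x, backward⟩, fun h ↦ ?_, fun h ↦ ?_⟩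
  · have hlim := ENNReal.tendsto_ofReal ((backward h).const_mul (C t))
    rw [mul_zero, ENNReal.ofReal_zero] at hlim
    refine tendsto_of_tendsto_of_tendsto_of_le_of_le tendsto_const_nhds hlim
      (fun n ↦ zero_le) fun n ↦ ?_
    refine (lengthDist_le_mul (hCpos t ht) (hLip t ht) (u n) x).trans_eq ?_
    rw [hlen, ENNReal.ofReal_mul (hCpos t ht).le]
  · have hle := tendsto_of_tendsto_of_tendsto_of_le_of_le tendsto_const_nhds h
      (fun n ↦ zero_le) fun n ↦ ofReal_le_lengthDist
        (fun a b => W2 (fun a' b' => dist a' b') (ι t a) (ι t b)) (u n) x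
    have := (ENNReal.tendsto_toReal ENNReal.zero_ne_top).comp hle
    simpa [Function.comp_def, ENNReal.toReal_ofReal (hW0 _ _)] using this
end

section
/- Let σ : ℝ² → ℝ² be the reflection σ(x) = −x. For any two measures μ, ν ∈ 𝒫₂(ℝ²) with σ_#μ = μ and σ_#ν = ν one has W_c(μ,ν) = W(μ,ν), where W is the L²-Wasserstein distance on ℝ² with the Euclidean distance and W_c is the cone Wasserstein distance with cost min(|x−y|, |x+y|). Moreover, for arbitrary μ, ν ∈ 𝒫₂(ℝ²) one has W_c(μ,ν) ≤ W(μ,ν). -/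
open MeasureTheory ENNReal

lemma inv_two_mul_add_self (a : ℝ≥0∞) : 2⁻¹ * (a + a) = a := by
  rw [← two_mul, ← mul_assoc, ENNReal.inv_mul_cancel two_ne_zero ofNat_ne_top, one_mul]

section ConeCost

variable {E : Type*} [NormedAddCommGroup E]

/-- The representative among `p.2` and `-p.2` nearest to `p.1`. -/
noncomputable def nearestSign (p : E × E) : E :=
  open Classical in if ‖p.1 - p.2‖ ≤ ‖p.1 + p.2‖ then p.2 else -p.2

lemma nearestSign_eq_or (p : E × E) : nearestSign p = p.2 ∨ nearestSign p = -p.2 := by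
  unfold nearestSign
  split_ifs <;> simp

lemma norm_sub_nearestSign (p : E × E) :
    ‖p.1 - nearestSign p‖ = min ‖p.1 - p.2‖ ‖p.1 + p.2‖ := by
  unfold nearestSign
  split_ifs with h
  · rw [min_eq_left h]
  · rw [min_eq_right (le_of_not_ge h), sub_neg_eq_add]

variable [MeasurableSpace E]

lemma transportCost_cone_le (μ ν : Measure E) :
    transportCost (fun x y => min ‖x - y‖ ‖x + y‖) μ ν ≤ transportCost (fun x y => ‖x - y‖) μ ν :=
  iInf₂_mono fun _ _ => lintegral_mono fun _ => ENNReal.ofReal_le_ofReal <|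
    pow_le_pow_left₀ (le_min (norm_nonneg _) (norm_nonneg _)) (min_le_left _ _) 2

variable [BorelSpace E]

lemma lintegral_comp_neg_of_map_neg {μ : Measure E} (hμ : μ.map (fun x => -x) = μ)
    {f : E → ℝ≥0∞} (hf : Measurable f) : ∫⁻ x, f (-x) ∂μ = ∫⁻ x, f x ∂μ := by
  conv_rhs => rw [← hμ, lintegral_map hf measurable_neg]

lemma inv_two_mul_lintegral_add_neg {Ω : Type*} [MeasurableSpace Ω] {π : Measure Ω}
    {μ : Measure E} (hμ : μ.map (fun x => -x) = μ) {g : Ω → E} (hg : Measurable g)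
    (hπ : π.map g = μ) {f : E → ℝ≥0∞} (hf : Measurable f) :
    2⁻¹ * ∫⁻ p, (f (g p) + f (-g p)) ∂π = ∫⁻ x, f x ∂μ := by
  have hneg : Measurable fun x => f (-x) := hf.comp measurable_neg
  rw [lintegral_add_left (show Measurable fun p => f (g p) from hf.comp hg),
    ← lintegral_map hf hg, ← lintegral_map hneg hg, hπ,
    lintegral_comp_neg_of_map_neg hμ hf, inv_two_mul_add_self]

variable [SecondCountableTopology E]

lemma measurable_nearestSign : Measurable (nearestSign : E × E → E) := by
  classical
  unfold nearestSign
  refine Measurable.ite ?_ measurable_snd measurable_snd.neg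
  exact measurableSet_le (measurable_fst.sub measurable_snd).norm
    (measurable_fst.add measurable_snd).norm

/-- The coupling obtained from `π` by replacing the second point by its nearest representative
and averaging over the global change of sign. -/
noncomputable def unfoldedCoupling (π : Measure (E × E)) : Measure (E × E) :=
  (2⁻¹ : ℝ≥0∞) • (π.map (fun p => (p.1, nearestSign p)) +
    π.map (fun p => (-p.1, -nearestSign p)))

lemma lintegral_unfoldedCoupling (π : Measure (E × E)) {f : E × E → ℝ≥0∞} (hf : Measurable f) :
    ∫⁻ p, f p ∂unfoldedCoupling π =
      2⁻¹ * ∫⁻ p, (f (p.1, nearestSign p) + f (-p.1, -nearestSign p)) ∂π := by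
  have h₁ : Measurable fun p : E × E => (p.1, nearestSign p) :=
    measurable_fst.prodMk measurable_nearestSign
  have h₂ : Measurable fun p : E × E => (-p.1, -nearestSign p) :=
    measurable_fst.neg.prodMk measurable_nearestSign.neg
  rw [unfoldedCoupling, lintegral_smul_measure, lintegral_add_measure, lintegral_map hf h₁,
    lintegral_map hf h₂, smul_eq_mul,
    lintegral_add_left (show Measurable fun p => f (p.1, nearestSign p) from hf.comp h₁)]

lemma IsCoupling.unfoldedCoupling {π : Measure (E × E)} {μ ν : Measure E}
    (h : IsCoupling π μ ν) (hμ : μ.map (fun x => -x) = μ) (hν : ν.map (fun x => -x) = ν) :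
    IsCoupling (unfoldedCoupling π) μ ν := by
  constructor
  · refine Measure.ext_of_lintegral _ fun f hf => ?_
    rw [lintegral_map hf measurable_fst, lintegral_unfoldedCoupling π
      (show Measurable fun p : E × E => f p.1 from hf.comp measurable_fst)]
    exact inv_two_mul_lintegral_add_neg hμ measurable_fst h.1 hf
  · refine Measure.ext_of_lintegral _ fun f hf => ?_
    rw [lintegral_map hf measurable_snd, lintegral_unfoldedCoupling π
      (show Measurable fun p : E × E => f p.2 from hf.comp measurable_snd),
      ← inv_two_mul_lintegral_add_neg hν measurable_snd h.2 hf]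
    congr 1
    refine lintegral_congr fun p => ?_
    rcases nearestSign_eq_or p with hp | hp <;> simp [hp, add_comm]

lemma lintegral_dist_sq_unfoldedCoupling (π : Measure (E × E)) :
    ∫⁻ p, ENNReal.ofReal (‖p.1 - p.2‖ ^ 2) ∂unfoldedCoupling π =
      ∫⁻ p, ENNReal.ofReal (min ‖p.1 - p.2‖ ‖p.1 + p.2‖ ^ 2) ∂π := by
  have hm : Measurable fun p : E × E => ENNReal.ofReal (‖p.1 - p.2‖ ^ 2) := by fun_prop
  rw [lintegral_unfoldedCoupling π hm, ← lintegral_const_mul' _ _ (by simp)]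
  refine lintegral_congr fun p => ?_
  rw [neg_sub_neg, norm_sub_rev (nearestSign p), inv_two_mul_add_self]
  exact congrArg (fun t => ENNReal.ofReal (t ^ 2)) (norm_sub_nearestSign p)

lemma transportCost_le_cone {μ ν : Measure E} (hμ : μ.map (fun x => -x) = μ)
    (hν : ν.map (fun x => -x) = ν) :
    transportCost (fun x y => ‖x - y‖) μ ν ≤
      transportCost (fun x y => min ‖x - y‖ ‖x + y‖) μ ν :=
  le_iInf₂ fun π hπ => (iInf₂_le (unfoldedCoupling π) (hπ.unfoldedCoupling hμ hν)).trans_eq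
    (lintegral_dist_sq_unfoldedCoupling π)

lemma transportCost_norm_sub_lt_top {μ ν : Measure E} [IsProbabilityMeasure μ]
    [IsProbabilityMeasure ν] (hμ : ∫⁻ x, ENNReal.ofReal (‖x‖ ^ 2) ∂μ < ⊤)
    (hν : ∫⁻ x, ENNReal.ofReal (‖x‖ ^ 2) ∂ν < ⊤) :
    transportCost (fun x y => ‖x - y‖) μ ν < ⊤ := by
  have hm : Measurable fun x : E => ENNReal.ofReal (‖x‖ ^ 2) := by fun_prop
  have hπ : IsCoupling (μ.prod ν) μ ν := ⟨by simp, by simp⟩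
  refine (iInf₂_le (μ.prod ν) hπ).trans_lt ?_
  calc ∫⁻ p : E × E, ENNReal.ofReal (‖p.1 - p.2‖ ^ 2) ∂μ.prod ν
      ≤ ∫⁻ p : E × E, 2 * (ENNReal.ofReal (‖p.1‖ ^ 2) + ENNReal.ofReal (‖p.2‖ ^ 2))
          ∂μ.prod ν := by
        refine lintegral_mono fun p => ?_
        rw [← ENNReal.ofReal_add (by positivity) (by positivity),
          ← ENNReal.ofReal_ofNat 2, ← ENNReal.ofReal_mul (by positivity)]
        refine ENNReal.ofReal_le_ofReal ?_
        have h := norm_sub_le p.1 p.2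
        nlinarith [norm_nonneg (p.1 - p.2), sq_nonneg (‖p.1‖ - ‖p.2‖)]
    _ = 2 * (∫⁻ x, ENNReal.ofReal (‖x‖ ^ 2) ∂μ + ∫⁻ x, ENNReal.ofReal (‖x‖ ^ 2) ∂ν) := by
        rw [lintegral_const_mul' _ _ (by simp), lintegral_add_left
          (show Measurable fun p : E × E => ENNReal.ofReal (‖p.1‖ ^ 2) from hm.comp measurable_fst),
          ← lintegral_map hm measurable_fst, ← lintegral_map hm measurable_snd, hπ.1, hπ.2]
    _ < ⊤ := ENNReal.mul_lt_top (by simp) (ENNReal.add_lt_top.2 ⟨hμ, hν⟩)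

end ConeCost

/-- for measures on `ℝ²` symmetric under `x ↦ -x`, the cone Wasserstein
distance (cost `min (|x-y|, |x+y|)`) equals the Euclidean Wasserstein distance, and in
general the cone Wasserstein distance is dominated by the Euclidean one. -/
theorem stmt4 (μ ν : Measure (EuclideanSpace ℝ (Fin 2)))
    (hμ : IsProbabilityMeasure μ) (hν : IsProbabilityMeasure ν)
    (hμm : ∫⁻ x, ENNReal.ofReal (‖x‖ ^ 2) ∂μ < ⊤)
    (hνm : ∫⁻ x, ENNReal.ofReal (‖x‖ ^ 2) ∂ν < ⊤) :
    (μ.map (fun x => -x) = μ → ν.map (fun x => -x) = ν →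
      W2 (fun x y => min ‖x - y‖ ‖x + y‖) μ ν = W2 (fun x y => ‖x - y‖) μ ν) ∧
    W2 (fun x y => min ‖x - y‖ ‖x + y‖) μ ν ≤ W2 (fun x y => ‖x - y‖) μ ν := by
  refine ⟨fun hμs hνs => ?_, ?_⟩
  · unfold W2
    rw [(transportCost_cone_le μ ν).antisymm (transportCost_le_cone hμs hνs)]
  · exact Real.sqrt_le_sqrt <| ENNReal.toReal_mono
      (transportCost_norm_sub_lt_top hμm hνm).ne (transportCost_cone_le μ ν)
end

section
/- Let H_t denote the heat semigroup on ℝ²: for μ ∈ 𝒫₂(ℝ²) and t > 0, H_tμ is the measure with Lebesgue density p ↦ ∫ (4πt)^{-1} exp(−|p−q|²/(4t)) dμ(q), and H_0μ = μ. Let Ent(μ) := ∫ ρ log ρ dℒ if μ = ρℒ is absolutely continuous with respect to the Lebesgue measure ℒ (and +∞ otherwise). Then for every μ, χ ∈ 𝒫₂(ℝ²) with σ_#μ = μ, σ_#χ = χ (σ(x) = −x) and Ent(χ) < ∞, and every t ≥ 0: ½·W_c(H_tμ, χ)² − ½·W_c(μ, χ)² ≤ t·(Ent(χ) − Ent(H_tμ)).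 -/
open MeasureTheory ENNReal

/-- The density of the heat semigroup applied to `μ` on `ℝ²` at time `t > 0`. -/
noncomputable def heatDensity (t : ℝ) (μ : Measure (EuclideanSpace ℝ (Fin 2)))
    (p : EuclideanSpace ℝ (Fin 2)) : ℝ :=
  ∫ q, (4 * Real.pi * t)⁻¹ * Real.exp (-‖p - q‖ ^ 2 / (4 * t)) ∂μ

/-- The heat semigroup on `ℝ²` acting on measures (`H_0 μ = μ`). -/
noncomputable def heatFlow (t : ℝ) (μ : Measure (EuclideanSpace ℝ (Fin 2))) :
    Measure (EuclideanSpace ℝ (Fin 2)) :=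
  if t = 0 then μ else volume.withDensity fun p => ENNReal.ofReal (heatDensity t μ p)

/-- The Boltzmann entropy `Ent(μ) = ∫ ρ log ρ dℒ` of `μ = ρ ℒ`, written as
`∫ log (dμ/dℒ) dμ`. -/
noncomputable def Ent (μ : Measure (EuclideanSpace ℝ (Fin 2))) : ℝ :=
  ∫ p, Real.log ((μ.rnDeriv volume p).toReal) ∂μ

local notation "ℝ²" => EuclideanSpace ℝ (Fin 2)

section L2

variable {Ω F : Type*} [MeasurableSpace Ω] {P : Measure Ω} [NormedAddCommGroup F]
  [InnerProductSpace ℝ F]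

lemma integrable_inner_of_memLp_two {f g : Ω → F} (hf : MemLp f 2 P) (hg : MemLp g 2 P) :
    Integrable (fun x => inner ℝ (f x) (g x)) P := by
  refine (hf.integrable_norm_pow two_ne_zero |>.add (hg.integrable_norm_pow two_ne_zero)).mono'
    (hf.1.inner hg.1) (Filter.Eventually.of_forall fun x => ?_)
  simp only [Pi.add_apply]
  nlinarith [norm_inner_le_norm (𝕜 := ℝ) (f x) (g x), sq_nonneg (‖f x‖ - ‖g x‖),
    sq_nonneg (‖f x‖), sq_nonneg (‖g x‖)]

lemma integral_norm_add_sq {f g : Ω → F} (hf : MemLp f 2 P) (hg : MemLp g 2 P) :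
    ∫ x, ‖f x + g x‖ ^ 2 ∂P =
      ∫ x, ‖f x‖ ^ 2 ∂P + 2 * ∫ x, inner ℝ (f x) (g x) ∂P + ∫ x, ‖g x‖ ^ 2 ∂P := by
  have hi := (integrable_inner_of_memLp_two hf hg).const_mul 2
  have hf' := hf.integrable_norm_pow two_ne_zero
  have hg' := hg.integrable_norm_pow two_ne_zero
  have hfi := hf'.add hi
  simp only [Pi.add_def] at hfi
  rw [← integral_const_mul, ← integral_add hf' hi, ← integral_add hfi hg']
  simp only [norm_add_sq_real]

lemma integral_inner_le_sqrt_mul_sqrt {f g : Ω → F} (hf : MemLp f 2 P) (hg : MemLp g 2 P) :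
    ∫ x, inner ℝ (f x) (g x) ∂P ≤ √(∫ x, ‖f x‖ ^ 2 ∂P) * √(∫ x, ‖g x‖ ^ 2 ∂P) := by
  have h2 : ENNReal.ofReal 2 = 2 := by simp
  have h := integral_mul_norm_le_Lp_mul_Lq (μ := P) (f := f) (g := g) (p := 2) (q := 2)
    (by constructor <;> norm_num) (by rwa [h2]) (by rwa [h2])
  simp only [Real.rpow_two, ← Real.sqrt_eq_rpow] at h
  refine (integral_mono (integrable_inner_of_memLp_two hf hg) ?_
    fun x => real_inner_le_norm (f x) (g x)).trans h
  exact MemLp.integrable_mul hf.norm hg.norm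

end L2

/-- The heat kernel on `ℝ²`. -/
noncomputable def heatKernel (τ : ℝ) (z : ℝ²) : ℝ :=
  (4 * Real.pi * τ)⁻¹ * Real.exp (-‖z‖ ^ 2 / (4 * τ))

lemma heatKernel_pos {τ : ℝ} (hτ : 0 < τ) (z : ℝ²) : 0 < heatKernel τ z := by
  unfold heatKernel; positivity

lemma continuous_heatKernel (τ : ℝ) : Continuous (heatKernel τ) := by
  unfold heatKernel; fun_prop

lemma heatKernel_le {τ : ℝ} (hτ : 0 < τ) (z : ℝ²) : heatKernel τ z ≤ (4 * Real.pi * τ)⁻¹ := by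
  unfold heatKernel
  refine mul_le_of_le_one_right (by positivity) (Real.exp_le_one_iff.2 ?_)
  rw [neg_div]
  exact neg_nonpos.2 (by positivity)

lemma heatKernel_mul_sq_le {τ : ℝ} (hτ : 0 < τ) (z : ℝ²) :
    heatKernel τ z * ‖z‖ ^ 2 ≤ Real.pi⁻¹ := by
  unfold heatKernel
  have h1 : ‖z‖ ^ 2 / (4 * τ) * Real.exp (-‖z‖ ^ 2 / (4 * τ)) ≤ 1 := by
    rw [neg_div, Real.exp_neg, ← div_eq_mul_inv, div_le_one (Real.exp_pos _)]
    linarith [Real.add_one_le_exp (‖z‖ ^ 2 / (4 * τ))]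
  calc _ = Real.pi⁻¹ * (‖z‖ ^ 2 / (4 * τ) * Real.exp (-‖z‖ ^ 2 / (4 * τ))) := by
        field_simp
    _ ≤ Real.pi⁻¹ * 1 := by gcongr
    _ = _ := mul_one _

lemma integrable_exp_neg_mul_norm_sq {b : ℝ} (hb : 0 < b) :
    Integrable (fun z : ℝ² => Real.exp (-b * ‖z‖ ^ 2)) := by
  by_contra h
  have h1 := GaussianFourier.integral_rexp_neg_mul_sq_norm (V := ℝ²) hb
  rw [integral_undef h] at h1
  have : 0 < (Real.pi / b) ^ ((Module.finrank ℝ ℝ² : ℝ) / 2) := by positivity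
  linarith

lemma heatKernel_eq (τ : ℝ) (z : ℝ²) :
    heatKernel τ z = (4 * Real.pi * τ)⁻¹ * Real.exp (-(4 * τ)⁻¹ * ‖z‖ ^ 2) := by
  unfold heatKernel
  congr 2
  ring

lemma integrable_heatKernel {τ : ℝ} (hτ : 0 < τ) : Integrable (heatKernel τ) := by
  simp_rw [funext (heatKernel_eq τ)]
  exact (integrable_exp_neg_mul_norm_sq (by positivity)).const_mul _

lemma integral_heatKernel {τ : ℝ} (hτ : 0 < τ) : ∫ z, heatKernel τ z = 1 := by
  simp_rw [heatKernel_eq τ]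
  rw [integral_const_mul, GaussianFourier.integral_rexp_neg_mul_sq_norm (by positivity)]
  simp
  field_simp

lemma lintegral_heatKernel {τ : ℝ} (hτ : 0 < τ) :
    ∫⁻ z, ENNReal.ofReal (heatKernel τ z) = 1 := by
  rw [← ofReal_integral_eq_lintegral_ofReal (integrable_heatKernel hτ)
    (ae_of_all _ fun z => (heatKernel_pos hτ z).le), integral_heatKernel hτ, ENNReal.ofReal_one]

/-- The law of the heat kernel on `ℝ²` at time one. -/
noncomputable def stdHeat : Measure ℝ² :=
  volume.withDensity fun w => ENNReal.ofReal (heatKernel 1 w)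

instance : IsProbabilityMeasure stdHeat :=
  ⟨by rw [stdHeat, withDensity_apply _ .univ, setLIntegral_univ, lintegral_heatKernel one_pos]⟩

@[fun_prop]
lemma measurable_heatKernel (τ : ℝ) : Measurable (heatKernel τ) :=
  (continuous_heatKernel τ).measurable

lemma integrable_norm_sq_stdHeat : Integrable (fun w : ℝ² => ‖w‖ ^ 2) stdHeat := by
  rw [stdHeat, integrable_withDensity_iff_integrable_smul'
    (measurable_heatKernel 1).ennreal_ofReal (ae_of_all _ fun _ => ofReal_lt_top)]
  refine ((integrable_exp_neg_mul_norm_sq (b := 1 / 8) (by norm_num)).const_mul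
    (8 * (4 * Real.pi)⁻¹)).mono' ?_ (ae_of_all _ fun w => ?_)
  · exact ((measurable_heatKernel 1).ennreal_ofReal.ennreal_toReal.smul
      (by fun_prop)).aestronglyMeasurable
  · rw [ENNReal.toReal_ofReal (heatKernel_pos one_pos w).le, smul_eq_mul, Real.norm_eq_abs,
      abs_of_nonneg (by have := heatKernel_pos one_pos w; positivity), heatKernel_eq]
    have h1 := Real.add_one_le_exp (‖w‖ ^ 2 / 8)
    have h2 : Real.exp (-(4 * 1)⁻¹ * ‖w‖ ^ 2) * Real.exp (‖w‖ ^ 2 / 8)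
        = Real.exp (-(1 / 8) * ‖w‖ ^ 2) := by
      rw [← Real.exp_add]; congr 1; ring
    rw [← h2]
    have h3 : 0 < Real.exp (-(4 * 1)⁻¹ * ‖w‖ ^ 2) := Real.exp_pos _
    have h4 : 0 < (4 * Real.pi)⁻¹ := by positivity
    rw [mul_one]
    calc (4 * Real.pi)⁻¹ * Real.exp (-(4 * 1)⁻¹ * ‖w‖ ^ 2) * ‖w‖ ^ 2
        ≤ (4 * Real.pi)⁻¹ * Real.exp (-(4 * 1)⁻¹ * ‖w‖ ^ 2) * (8 * Real.exp (‖w‖ ^ 2 / 8)) := by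
          gcongr; linarith
      _ = _ := by ring

lemma lintegral_comp_add_smul_stdHeat {τ : ℝ} (hτ : 0 < τ) (q : ℝ²) {F : ℝ² → ℝ≥0∞}
    (hF : Measurable F) :
    ∫⁻ w, F (q + √τ • w) ∂stdHeat = ∫⁻ p, ENNReal.ofReal (heatKernel τ (p - q)) * F p := by
  have hs : 0 < √τ := Real.sqrt_pos.2 hτ
  have e1 : ∀ w : ℝ², ENNReal.ofReal (heatKernel 1 w) =
      ENNReal.ofReal τ * ENNReal.ofReal (heatKernel τ (√τ • w)) := fun w => by
    rw [← ENNReal.ofReal_mul hτ.le]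
    congr 1
    rw [heatKernel, heatKernel, norm_smul, Real.norm_eq_abs, abs_of_pos hs, mul_pow,
      Real.sq_sqrt hτ.le, ← mul_assoc]
    congr 1
    · field_simp
    · congr 1; field_simp
  rw [stdHeat, lintegral_withDensity_eq_lintegral_mul _
    (measurable_heatKernel 1).ennreal_ofReal (by fun_prop)]
  simp only [Pi.mul_apply, e1]
  have e2 := lintegral_map (μ := (volume : Measure ℝ²)) (g := fun w => √τ • w)
    (f := fun p => ENNReal.ofReal (heatKernel τ p) * F (q + p)) (by fun_prop) (by fun_prop)
  rw [Measure.map_addHaar_smul _ hs.ne', lintegral_smul_measure] at e2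
  simp_rw [mul_assoc]
  rw [lintegral_const_mul _ (by fun_prop), ← e2, smul_eq_mul, ← mul_assoc, ← ENNReal.ofReal_mul hτ.le]
  have : τ * |(√τ ^ Module.finrank ℝ ℝ²)⁻¹| = 1 := by
    simp [abs_of_pos hτ, hτ.le]
    field_simp
  rw [this, ENNReal.ofReal_one, one_mul,
    ← lintegral_add_left_eq_self (fun p => ENNReal.ofReal (heatKernel τ (p - q)) * F p) q]
  simp only [add_sub_cancel_left]

lemma map_add_smul_prod_eq_withDensity {τ : ℝ} (hτ : 0 < τ) (ν : Measure ℝ²)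
    [IsProbabilityMeasure ν] :
    (ν.prod stdHeat).map (fun p => (p.1 + √τ • p.2, p.1)) =
      ((volume : Measure ℝ²).prod ν).withDensity
        fun p => ENNReal.ofReal (heatKernel τ (p.1 - p.2)) := by
  have hk : Measurable fun p : ℝ² × ℝ² => ENNReal.ofReal (heatKernel τ (p.1 - p.2)) :=
    ((measurable_heatKernel τ).comp (by fun_prop)).ennreal_ofReal
  refine Measure.ext_of_lintegral _ fun F hF => ?_
  rw [lintegral_map hF (by fun_prop), lintegral_withDensity_eq_lintegral_mul _ hk hF,
    lintegral_prod _ (by fun_prop), lintegral_prod_symm _ (hk.mul hF).aemeasurable]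
  refine lintegral_congr fun q => ?_
  exact lintegral_comp_add_smul_stdHeat hτ q (F := fun p => F (p, q)) (by fun_prop)

lemma heatDensity_eq (τ : ℝ) (ν : Measure ℝ²) (p : ℝ²) :
    heatDensity τ ν p = ∫ q, heatKernel τ (p - q) ∂ν := rfl

lemma integrable_heatKernel_sub {τ : ℝ} (hτ : 0 < τ) (ν : Measure ℝ²) [IsProbabilityMeasure ν]
    (p : ℝ²) : Integrable (fun q => heatKernel τ (p - q)) ν :=
  .of_bound (C := (4 * Real.pi * τ)⁻¹) (Measurable.aestronglyMeasurable (by fun_prop))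
    (ae_of_all _ fun q => by
      rw [Real.norm_eq_abs, abs_of_pos (heatKernel_pos hτ _)]; exact heatKernel_le hτ _)

lemma heatDensity_pos {τ : ℝ} (hτ : 0 < τ) (ν : Measure ℝ²) [IsProbabilityMeasure ν] (p : ℝ²) :
    0 < heatDensity τ ν p := by
  rw [heatDensity_eq, integral_pos_iff_support_of_nonneg (fun q => (heatKernel_pos hτ _).le)
    (integrable_heatKernel_sub hτ ν p)]
  have : (Function.support fun q => heatKernel τ (p - q)) = Set.univ :=
    Set.eq_univ_of_forall fun q => (heatKernel_pos hτ _).ne'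
  simp [this]

lemma heatDensity_le {τ : ℝ} (hτ : 0 < τ) (ν : Measure ℝ²) [IsProbabilityMeasure ν] (p : ℝ²) :
    heatDensity τ ν p ≤ (4 * Real.pi * τ)⁻¹ := by
  rw [heatDensity_eq]
  refine (integral_mono (integrable_heatKernel_sub hτ ν p) (integrable_const _)
    fun q => heatKernel_le hτ _).trans ?_
  simp

@[fun_prop]
lemma measurable_heatDensity (τ : ℝ) (ν : Measure ℝ²) [IsProbabilityMeasure ν] :
    Measurable (heatDensity τ ν) := by
  refine StronglyMeasurable.measurable ?_
  exact StronglyMeasurable.integral_prod_right'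
    (f := fun p : ℝ² × ℝ² => heatKernel τ (p.1 - p.2))
    (Measurable.stronglyMeasurable (by fun_prop))

lemma ofReal_heatDensity {τ : ℝ} (hτ : 0 < τ) (ν : Measure ℝ²) [IsProbabilityMeasure ν] (p : ℝ²) :
    ENNReal.ofReal (heatDensity τ ν p) = ∫⁻ q, ENNReal.ofReal (heatKernel τ (p - q)) ∂ν :=
  ofReal_integral_eq_lintegral_ofReal (integrable_heatKernel_sub hτ ν p)
    (ae_of_all _ fun _ => (heatKernel_pos hτ _).le)

lemma heatFlow_of_pos {τ : ℝ} (hτ : 0 < τ) (ν : Measure ℝ²) :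
    heatFlow τ ν = volume.withDensity fun p => ENNReal.ofReal (heatDensity τ ν p) :=
  if_neg hτ.ne'

/-- The heat flow is the law of the sum of an initial point and an independent Gaussian. -/
lemma map_add_smul_prod_stdHeat {τ : ℝ} (hτ : 0 < τ) (ν : Measure ℝ²) [IsProbabilityMeasure ν] :
    (ν.prod stdHeat).map (fun p => p.1 + √τ • p.2) = heatFlow τ ν := by
  have h := congrArg (Measure.map Prod.fst) (map_add_smul_prod_eq_withDensity hτ ν)
  rw [Measure.map_map (by fun_prop) (by fun_prop)] at h
  refine Eq.trans h ?_
  rw [heatFlow_of_pos hτ]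
  refine Measure.ext_of_lintegral _ fun F hF => ?_
  rw [lintegral_map hF (by fun_prop), lintegral_withDensity_eq_lintegral_mul _ (by fun_prop)
    (by fun_prop), lintegral_withDensity_eq_lintegral_mul _ (by fun_prop) hF,
    lintegral_prod _ (by fun_prop)]
  refine lintegral_congr fun p => ?_
  simp only [Pi.mul_apply, ofReal_heatDensity hτ]
  rw [lintegral_mul_const _ (by fun_prop)]

lemma isProbabilityMeasure_heatFlow {τ : ℝ} (hτ : 0 < τ) (ν : Measure ℝ²)
    [IsProbabilityMeasure ν] : IsProbabilityMeasure (heatFlow τ ν) := by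
  rw [← map_add_smul_prod_stdHeat hτ]
  exact Measure.isProbabilityMeasure_map (by fun_prop)

lemma log_rnDeriv_heatFlow {τ : ℝ} (hτ : 0 < τ) (ν : Measure ℝ²) [IsProbabilityMeasure ν] :
    (fun p => Real.log (((heatFlow τ ν).rnDeriv volume p).toReal)) =ᵐ[heatFlow τ ν]
      fun p => Real.log (heatDensity τ ν p) := by
  have h : (heatFlow τ ν).rnDeriv volume =ᵐ[volume]
      fun p => ENNReal.ofReal (heatDensity τ ν p) := by
    rw [heatFlow_of_pos hτ]
    exact Measure.rnDeriv_withDensity _ (by fun_prop)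
  have hac : heatFlow τ ν ≪ volume := by
    rw [heatFlow_of_pos hτ]; exact withDensity_absolutelyContinuous _ _
  filter_upwards [hac.ae_le h] with p hp
  rw [hp, ENNReal.toReal_ofReal (heatDensity_pos hτ ν p).le]

/-- The entropy of the heat flow in terms of its explicit density. -/
lemma Ent_heatFlow {τ : ℝ} (hτ : 0 < τ) (ν : Measure ℝ²) [IsProbabilityMeasure ν] :
    Ent (heatFlow τ ν) = ∫ p, Real.log (heatDensity τ ν p) ∂(heatFlow τ ν) :=
  integral_congr_ae (log_rnDeriv_heatFlow hτ ν)

/-- The mean of the displacement `z - q` under the posterior law of the initial point `q` given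
that the heat flow started from `ν` is at `z` at time `τ`. -/
noncomputable def posteriorMean (τ : ℝ) (ν : Measure ℝ²) (z : ℝ²) : ℝ² :=
  (heatDensity τ ν z)⁻¹ • ∫ q, heatKernel τ (z - q) • (z - q) ∂ν

@[fun_prop]
lemma measurable_posteriorMean (τ : ℝ) (ν : Measure ℝ²) [IsProbabilityMeasure ν] :
    Measurable (posteriorMean τ ν) := by
  refine (measurable_heatDensity τ ν).inv.smul (StronglyMeasurable.measurable ?_)
  exact StronglyMeasurable.integral_prod_right'
    (f := fun p : ℝ² × ℝ² => heatKernel τ (p.1 - p.2) • (p.1 - p.2))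
    (Measurable.stronglyMeasurable (by fun_prop))

lemma integrable_heatKernel_sub_mul_sq {τ : ℝ} (hτ : 0 < τ) (ν : Measure ℝ²)
    [IsProbabilityMeasure ν] (z : ℝ²) :
    Integrable (fun q => heatKernel τ (z - q) * ‖z - q‖ ^ 2) ν :=
  .of_bound (C := Real.pi⁻¹) (Measurable.aestronglyMeasurable (by fun_prop))
    (ae_of_all _ fun q => by
      rw [Real.norm_eq_abs, abs_of_nonneg (mul_nonneg (heatKernel_pos hτ _).le (sq_nonneg _))]
      exact heatKernel_mul_sq_le hτ _)

lemma integrable_heatKernel_sub_smul {τ : ℝ} (hτ : 0 < τ) (ν : Measure ℝ²)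
    [IsProbabilityMeasure ν] (z : ℝ²) :
    Integrable (fun q => heatKernel τ (z - q) • (z - q)) ν := by
  refine ((integrable_heatKernel_sub hτ ν z).add (integrable_heatKernel_sub_mul_sq hτ ν z)).mono'
    (Measurable.aestronglyMeasurable (by fun_prop)) (ae_of_all _ fun q => ?_)
  have := heatKernel_pos hτ (z - q)
  rw [norm_smul, Real.norm_eq_abs, abs_of_pos this]
  simp only [Pi.add_apply]
  nlinarith [sq_nonneg (‖z - q‖ - 1), sq_nonneg ‖z - q‖]

lemma integral_heatKernel_sub_smul {τ : ℝ} (hτ : 0 < τ) (ν : Measure ℝ²)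
    [IsProbabilityMeasure ν] (z : ℝ²) :
    ∫ q, heatKernel τ (z - q) • (z - q) ∂ν = heatDensity τ ν z • posteriorMean τ ν z := by
  rw [posteriorMean, smul_inv_smul₀ (heatDensity_pos hτ ν z).ne']

lemma integral_heatKernel_mul_inner {τ : ℝ} (hτ : 0 < τ) (ν : Measure ℝ²)
    [IsProbabilityMeasure ν] (z v : ℝ²) :
    ∫ q, heatKernel τ (z - q) * inner ℝ v (z - q) ∂ν =
      heatDensity τ ν z * inner ℝ v (posteriorMean τ ν z) := by
  have := integral_inner (𝕜 := ℝ) (integrable_heatKernel_sub_smul hτ ν z) v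
  simp_rw [inner_smul_right] at this
  rw [this, integral_heatKernel_sub_smul hτ, inner_smul_right]

lemma integrable_heatKernel_mul_inner {τ : ℝ} (hτ : 0 < τ) (ν : Measure ℝ²)
    [IsProbabilityMeasure ν] (z v : ℝ²) :
    Integrable (fun q => heatKernel τ (z - q) * inner ℝ v (z - q)) ν := by
  have := (integrable_heatKernel_sub_smul hτ ν z).const_inner (𝕜 := ℝ) v
  simpa only [inner_smul_right] using this

/-- The logarithm of the heat flow density at time `τ` is `-(2τ)⁻¹`-convex. -/
lemma log_heatDensity_ge {τ : ℝ} (hτ : 0 < τ) (ν : Measure ℝ²) [IsProbabilityMeasure ν]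
    (y z : ℝ²) :
    Real.log (heatDensity τ ν z) - ‖y - z‖ ^ 2 / (4 * τ)
      - inner ℝ (y - z) (posteriorMean τ ν z) / (2 * τ) ≤ Real.log (heatDensity τ ν y) := by
  set β := -‖y - z‖ ^ 2 / (4 * τ) - inner ℝ (y - z) (posteriorMean τ ν z) / (2 * τ) with hβ
  have hz := heatDensity_pos hτ ν z
  have hy := heatDensity_pos hτ ν y
  have key : Real.exp β * heatDensity τ ν z ≤ heatDensity τ ν y := by
    have h1 : ∀ q, Real.exp β * (heatKernel τ (z - q) * (1 - ‖y - z‖ ^ 2 / (4 * τ) - β)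
        - (2 * τ)⁻¹ * (heatKernel τ (z - q) * inner ℝ (y - z) (z - q))) ≤
        heatKernel τ (y - q) := fun q => by
      have e : heatKernel τ (y - q) = heatKernel τ (z - q) * (Real.exp β *
          Real.exp (-‖y - z‖ ^ 2 / (4 * τ) - inner ℝ (y - z) (z - q) / (2 * τ) - β)) := by
        rw [heatKernel, heatKernel, ← Real.exp_add, mul_assoc _ (Real.exp _) (Real.exp _),
          ← Real.exp_add]
        congr 2
        have : y - q = (y - z) + (z - q) := by abel
        rw [this, norm_add_sq_real]
        field_simp
        ring
      rw [e]
      have := Real.add_one_le_exp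
        (-‖y - z‖ ^ 2 / (4 * τ) - inner ℝ (y - z) (z - q) / (2 * τ) - β)
      have hk := heatKernel_pos hτ (z - q)
      calc _ = heatKernel τ (z - q) * (Real.exp β * (-‖y - z‖ ^ 2 / (4 * τ)
            - inner ℝ (y - z) (z - q) / (2 * τ) - β + 1)) := by field_simp; ring
        _ ≤ _ := by gcongr
    have i1 := (integrable_heatKernel_sub hτ ν z).mul_const (1 - ‖y - z‖ ^ 2 / (4 * τ) - β)
    have i2 := (integrable_heatKernel_mul_inner hτ ν z (y - z)).const_mul (2 * τ)⁻¹
    have h2 := integral_mono ((i1.sub i2).const_mul (Real.exp β))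
      (integrable_heatKernel_sub hτ ν y) h1
    rw [integral_const_mul] at h2
    simp only [Pi.sub_apply] at h2
    rw [integral_sub i1 i2, integral_mul_const,
      integral_const_mul, integral_heatKernel_mul_inner hτ, ← heatDensity_eq, ← heatDensity_eq] at h2
    refine le_trans (le_of_eq ?_) h2
    rw [hβ]
    congr 1
    field_simp
    ring
  have := Real.log_le_log (by positivity) key
  rw [Real.log_mul (Real.exp_pos _).ne' hz.ne', Real.log_exp, hβ] at this
  rw [neg_div] at this
  linarith

lemma heatDensity_mul_posteriorMean_sq_le {τ : ℝ} (hτ : 0 < τ) (ν : Measure ℝ²)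
    [IsProbabilityMeasure ν] (z : ℝ²) :
    heatDensity τ ν z * ‖posteriorMean τ ν z‖ ^ 2 ≤
      ∫ q, heatKernel τ (z - q) * ‖z - q‖ ^ 2 ∂ν := by
  set b := posteriorMean τ ν z
  have i1 := (integrable_heatKernel_sub_mul_sq hτ ν z)
  have i2 := (integrable_heatKernel_mul_inner hτ ν z b).const_mul 2
  have i3 := (integrable_heatKernel_sub hτ ν z).mul_const (‖b‖ ^ 2)
  have h : 0 ≤ ∫ q, heatKernel τ (z - q) * ‖z - q‖ ^ 2 - 2 * (heatKernel τ (z - q) *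
      inner ℝ b (z - q)) + heatKernel τ (z - q) * ‖b‖ ^ 2 ∂ν := by
    refine integral_nonneg fun q => ?_
    have : 0 ≤ heatKernel τ (z - q) * ‖b - (z - q)‖ ^ 2 :=
      mul_nonneg (heatKernel_pos hτ _).le (sq_nonneg _)
    rw [norm_sub_sq_real] at this
    simp only [Pi.zero_apply]
    linarith
  have i4 := i1.sub i2
  simp only [Pi.sub_def] at i4
  rw [integral_add i4 i3, integral_sub i1 i2, integral_const_mul, integral_mul_const,
    integral_heatKernel_mul_inner hτ, real_inner_self_eq_norm_sq, ← heatDensity_eq] at h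
  linarith

lemma integrable_norm_sq_prod_snd (ν : Measure ℝ²) [IsProbabilityMeasure ν] :
    Integrable (fun p : ℝ² × ℝ² => ‖p.2‖ ^ 2) (ν.prod stdHeat) :=
  integrable_norm_sq_stdHeat.comp_snd ν

lemma memLp_posteriorMean {τ : ℝ} (hτ : 0 < τ) (ν : Measure ℝ²) [IsProbabilityMeasure ν] :
    MemLp (posteriorMean τ ν) 2 (heatFlow τ ν) := by
  rw [memLp_two_iff_integrable_sq_norm (measurable_posteriorMean τ ν).aestronglyMeasurable]
  have h1 : Integrable (fun p : ℝ² × ℝ² => ‖p.1 - p.2‖ ^ 2)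
      ((ν.prod stdHeat).map (fun p => (p.1 + √τ • p.2, p.1))) := by
    rw [integrable_map_measure (Measurable.aestronglyMeasurable (by fun_prop)) (by fun_prop)]
    refine ((integrable_norm_sq_prod_snd ν).const_mul τ).congr (ae_of_all _ fun p => ?_)
    simp [norm_smul, mul_pow, Real.sq_sqrt hτ.le]
  rw [map_add_smul_prod_eq_withDensity hτ, integrable_withDensity_iff_integrable_smul'
    (by fun_prop) (ae_of_all _ fun _ => ofReal_lt_top)] at h1
  rw [heatFlow_of_pos hτ, integrable_withDensity_iff_integrable_smul'
    (by fun_prop) (ae_of_all _ fun _ => ofReal_lt_top)]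
  refine h1.integral_prod_left.mono' (Measurable.aestronglyMeasurable (by fun_prop))
    (ae_of_all _ fun z => ?_)
  have hz := heatDensity_pos hτ ν z
  simp only [smul_eq_mul, ENNReal.toReal_ofReal (heatKernel_pos hτ _).le,
    ENNReal.toReal_ofReal hz.le]
  rw [Real.norm_eq_abs, abs_of_nonneg (by positivity)]
  exact heatDensity_mul_posteriorMean_sq_le hτ ν z

lemma integral_inner_posteriorMean {τ : ℝ} (hτ : 0 < τ) (ν : Measure ℝ²) [IsProbabilityMeasure ν]
    {f : ℝ² → ℝ²} (hf : MemLp f 2 (heatFlow τ ν)) (hfm : Measurable f) :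
    ∫ z, inner ℝ (f z) (posteriorMean τ ν z) ∂(heatFlow τ ν) =
      √τ * ∫ p, inner ℝ (f (p.1 + √τ • p.2)) p.2 ∂(ν.prod stdHeat) := by
  have hw : MemLp (fun p : ℝ² × ℝ² => p.2) 2 (ν.prod stdHeat) := by
    rw [memLp_two_iff_integrable_sq_norm (Measurable.aestronglyMeasurable (by fun_prop))]
    exact integrable_norm_sq_prod_snd ν
  have hfY : MemLp (fun p : ℝ² × ℝ² => f (p.1 + √τ • p.2)) 2 (ν.prod stdHeat) := by
    rw [← map_add_smul_prod_stdHeat hτ] at hf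
    exact hf.comp_of_map (by fun_prop)
  have hI : Integrable (fun p : ℝ² × ℝ² => inner ℝ (f (p.1 + √τ • p.2)) (√τ • p.2))
      (ν.prod stdHeat) := integrable_inner_of_memLp_two hfY (hw.const_smul √τ)
  have hm : Measurable (fun p : ℝ² × ℝ² => inner ℝ (f p.1) (p.1 - p.2)) := by fun_prop
  have h1 : Integrable (fun p : ℝ² × ℝ² => inner ℝ (f p.1) (p.1 - p.2))
      ((ν.prod stdHeat).map (fun p => (p.1 + √τ • p.2, p.1))) := by
    rw [integrable_map_measure hm.aestronglyMeasurable (by fun_prop)]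
    refine hI.congr (ae_of_all _ fun p => ?_)
    simp
  have h2 : ∫ p, inner ℝ (f p.1) (p.1 - p.2)
      ∂((ν.prod stdHeat).map (fun p => (p.1 + √τ • p.2, p.1))) =
      √τ * ∫ p, inner ℝ (f (p.1 + √τ • p.2)) p.2 ∂(ν.prod stdHeat) := by
    rw [integral_map (by fun_prop) hm.aestronglyMeasurable, ← integral_const_mul]
    refine integral_congr_ae (ae_of_all _ fun p => ?_)
    simp [inner_smul_right]
  rw [← h2]
  rw [map_add_smul_prod_eq_withDensity hτ, integrable_withDensity_iff_integrable_smul'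
    (by fun_prop) (ae_of_all _ fun _ => ofReal_lt_top)] at h1
  rw [map_add_smul_prod_eq_withDensity hτ, integral_withDensity_eq_integral_toReal_smul
    (by fun_prop) (ae_of_all _ fun _ => ofReal_lt_top), integral_prod _ h1,
    heatFlow_of_pos hτ, integral_withDensity_eq_integral_toReal_smul
    (by fun_prop) (ae_of_all _ fun _ => ofReal_lt_top)]
  refine integral_congr_ae (ae_of_all _ fun z => ?_)
  simp only [smul_eq_mul, ENNReal.toReal_ofReal (heatKernel_pos hτ _).le,
    ENNReal.toReal_ofReal (heatDensity_pos hτ ν z).le]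
  rw [integral_heatKernel_mul_inner hτ]

lemma integrable_norm_sq_heatFlow {τ : ℝ} (hτ : 0 < τ) {ν : Measure ℝ²} [IsProbabilityMeasure ν]
    (hν : Integrable (fun x => ‖x‖ ^ 2) ν) : Integrable (fun x => ‖x‖ ^ 2) (heatFlow τ ν) := by
  rw [← map_add_smul_prod_stdHeat hτ, integrable_map_measure
    (Measurable.aestronglyMeasurable (by fun_prop)) (by fun_prop)]
  have h1 : MemLp (fun p : ℝ² × ℝ² => p.1) 2 (ν.prod stdHeat) := by
    rw [memLp_two_iff_integrable_sq_norm (Measurable.aestronglyMeasurable (by fun_prop))]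
    exact hν.comp_fst stdHeat
  have h2 : MemLp (fun p : ℝ² × ℝ² => p.2) 2 (ν.prod stdHeat) := by
    rw [memLp_two_iff_integrable_sq_norm (Measurable.aestronglyMeasurable (by fun_prop))]
    exact integrable_norm_sq_prod_snd ν
  exact (h1.add (h2.const_smul √τ)).integrable_norm_pow two_ne_zero

lemma integrable_log_heatDensity {τ : ℝ} (hτ : 0 < τ) (ν : Measure ℝ²) [IsProbabilityMeasure ν]
    {θ : Measure ℝ²} [IsProbabilityMeasure θ] (hθ : Integrable (fun x => ‖x‖ ^ 2) θ) :
    Integrable (fun y => Real.log (heatDensity τ ν y)) θ := by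
  set b := posteriorMean τ ν 0
  refine (((integrable_const (|Real.log (4 * Real.pi * τ)⁻¹| + |Real.log (heatDensity τ ν 0)| +
    ‖b‖ ^ 2 / (4 * τ))).add (hθ.const_mul (1 / (2 * τ))))).mono'
    (Measurable.aestronglyMeasurable (by fun_prop)) (ae_of_all _ fun y => ?_)
  have h1 := log_heatDensity_ge hτ ν y 0
  have h2 := Real.log_le_log (heatDensity_pos hτ ν y) (heatDensity_le hτ ν y)
  rw [sub_zero] at h1
  have h3 : inner ℝ y b ≤ (‖y‖ ^ 2 + ‖b‖ ^ 2) / 2 := by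
    nlinarith [real_inner_le_norm y b, sq_nonneg (‖y‖ - ‖b‖)]
  have h4 : inner ℝ y b / (2 * τ) ≤ (‖y‖ ^ 2 + ‖b‖ ^ 2) / 2 / (2 * τ) := by gcongr
  have h5 : ‖y‖ ^ 2 / (4 * τ) + (‖y‖ ^ 2 + ‖b‖ ^ 2) / 2 / (2 * τ) =
    ‖b‖ ^ 2 / (4 * τ) + 1 / (2 * τ) * ‖y‖ ^ 2 := by field_simp; ring
  have h6 : 0 ≤ ‖b‖ ^ 2 / (4 * τ) + 1 / (2 * τ) * ‖y‖ ^ 2 := by positivity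
  simp only [Pi.add_apply]
  rw [Real.norm_eq_abs, abs_le]
  constructor
  · linarith [neg_abs_le (Real.log (heatDensity τ ν 0)), abs_nonneg (Real.log (4 * Real.pi * τ)⁻¹)]
  · linarith [le_abs_self (Real.log (4 * Real.pi * τ)⁻¹), abs_nonneg (Real.log (heatDensity τ ν 0))]

/-- Gibbs' inequality. -/
lemma integral_log_le_Ent {θ : Measure ℝ²} [IsProbabilityMeasure θ] (hac : θ ≪ volume)
    (hθ : Integrable (fun p => Real.log ((θ.rnDeriv volume p).toReal)) θ) {f : ℝ² → ℝ}
    (hf : Measurable f) (hpos : ∀ x, 0 < f x) (hmass : ∫⁻ x, ENNReal.ofReal (f x) ≤ 1)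
    (hlog : Integrable (fun x => Real.log (f x)) θ) :
    ∫ x, Real.log (f x) ∂θ ≤ Ent θ := by
  set r : ℝ² → ℝ := fun p => (θ.rnDeriv volume p).toReal
  have hr : Measurable r := (Measure.measurable_rnDeriv _ _).ennreal_toReal
  have hr0 : ∀ᵐ x ∂θ, 0 < r x := by
    filter_upwards [Measure.rnDeriv_pos hac, hac.ae_le (Measure.rnDeriv_lt_top θ volume)]
      with x h1 h2
    exact ENNReal.toReal_pos h1.ne' h2.ne
  have hl : ∫⁻ x, ENNReal.ofReal (f x / r x) ∂θ ≤ 1 := by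
    rw [← lintegral_rnDeriv_mul hac (by fun_prop)]
    refine le_trans (lintegral_mono_ae ?_) hmass
    filter_upwards [Measure.rnDeriv_lt_top θ volume] with x hx
    rw [← ENNReal.ofReal_toReal hx.ne, ← ENNReal.ofReal_mul ENNReal.toReal_nonneg]
    refine ENNReal.ofReal_le_ofReal ?_
    change r x * (f x / r x) ≤ f x
    rcases eq_or_ne (r x) 0 with h | h
    · rw [h]; simpa using (hpos x).le
    · rw [mul_div_cancel₀ _ h]
  have hnn : ∀ x, 0 ≤ f x / r x := fun x => div_nonneg (hpos x).le ENNReal.toReal_nonneg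
  have hi : Integrable (fun x => f x / r x) θ := by
    refine ⟨(hf.div hr).aestronglyMeasurable, ?_⟩
    rw [hasFiniteIntegral_iff_ofReal (ae_of_all _ hnn)]
    exact hl.trans_lt one_lt_top
  have hi1 : ∫ x, f x / r x ∂θ ≤ 1 := by
    rw [integral_eq_lintegral_of_nonneg_ae (ae_of_all _ hnn) hi.1]
    exact ENNReal.toReal_le_of_le_ofReal zero_le_one (by simpa using hl)
  have h1 : ∫ x, Real.log (f x) - Real.log (r x) ∂θ ≤ ∫ x, f x / r x - 1 ∂θ := by
    refine integral_mono_ae (hlog.sub hθ) (hi.sub (integrable_const _)) ?_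
    filter_upwards [hr0] with x hx
    rw [← Real.log_div (hpos x).ne' hx.ne']
    exact Real.log_le_sub_one_of_pos (div_pos (hpos x) hx)
  rw [integral_sub hlog hθ, integral_sub hi (integrable_const _)] at h1
  simp only [integral_const, probReal_univ, smul_eq_mul, mul_one] at h1
  change _ ≤ ∫ x, Real.log (r x) ∂θ
  linarith

lemma heatFlow_absolutelyContinuous {τ : ℝ} (hτ : 0 < τ) (ν : Measure ℝ²) :
    heatFlow τ ν ≪ volume := by
  rw [heatFlow_of_pos hτ]
  exact withDensity_absolutelyContinuous _ _

lemma lintegral_heatDensity {τ : ℝ} (hτ : 0 < τ) (ν : Measure ℝ²) [IsProbabilityMeasure ν] :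
    ∫⁻ p, ENNReal.ofReal (heatDensity τ ν p) = 1 := by
  have := isProbabilityMeasure_heatFlow hτ ν
  have h := measure_univ (μ := heatFlow τ ν)
  rwa [heatFlow_of_pos hτ, withDensity_apply _ .univ, setLIntegral_univ] at h

lemma integrable_log_rnDeriv_heatFlow {τ : ℝ} (hτ : 0 < τ) {ν : Measure ℝ²}
    [IsProbabilityMeasure ν] (hν : Integrable (fun x => ‖x‖ ^ 2) ν) :
    Integrable (fun p => Real.log (((heatFlow τ ν).rnDeriv volume p).toReal)) (heatFlow τ ν) := by
  have := isProbabilityMeasure_heatFlow hτ ν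
  exact (integrable_log_heatDensity hτ ν (integrable_norm_sq_heatFlow hτ hν)).congr
    (log_rnDeriv_heatFlow hτ ν).symm

/-- The entropy does not increase along the heat flow. -/
lemma Ent_heatFlow_le {τ : ℝ} (hτ : 0 < τ) {θ : Measure ℝ²} [IsProbabilityMeasure θ]
    (hac : θ ≪ volume) (hθ : Integrable (fun p => Real.log ((θ.rnDeriv volume p).toReal)) θ)
    (hm : Integrable (fun x => ‖x‖ ^ 2) θ) : Ent (heatFlow τ θ) ≤ Ent θ := by
  have hp := isProbabilityMeasure_heatFlow hτ θ
  have hi := integrable_log_heatDensity hτ θ (integrable_norm_sq_heatFlow hτ hm)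
  rw [Ent_heatFlow hτ]
  rw [← map_add_smul_prod_stdHeat hτ] at hi ⊢
  rw [integrable_map_measure (Measurable.aestronglyMeasurable (by fun_prop)) (by fun_prop)] at hi
  simp only [Function.comp_def] at hi
  rw [integral_map (by fun_prop) (Measurable.aestronglyMeasurable (by fun_prop)),
    integral_prod_symm _ hi]
  have key : ∀ᵐ w ∂stdHeat, ∫ q, Real.log (heatDensity τ θ (q + √τ • w)) ∂θ ≤ Ent θ := by
    filter_upwards [hi.prod_left_ae] with w hw
    refine integral_log_le_Ent hac hθ (by fun_prop) (fun _ => heatDensity_pos hτ _ _) ?_ hw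
    rw [lintegral_add_right_eq_self (fun p => ENNReal.ofReal (heatDensity τ θ p)),
      lintegral_heatDensity hτ]
  refine (integral_mono_ae hi.integral_prod_right (integrable_const (Ent θ)) key).trans ?_
  simp

/-- Comparison of the entropy of the heat flow with the entropy of another measure, along a
coupling of the two. -/
lemma Ent_heatFlow_le_of_coupling {τ : ℝ} (hτ : 0 < τ) {ν θ : Measure ℝ²}
    [IsProbabilityMeasure ν] [IsProbabilityMeasure θ] (hν : Integrable (fun x => ‖x‖ ^ 2) ν)
    (hac : θ ≪ volume) (hθ : Integrable (fun p => Real.log ((θ.rnDeriv volume p).toReal)) θ)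
    (hm : Integrable (fun x => ‖x‖ ^ 2) θ) {J : Measure (ℝ² × ℝ²)}
    (hJ : IsCoupling J (heatFlow τ ν) θ) :
    Ent (heatFlow τ ν) + (2 * τ)⁻¹ * ∫ p, inner ℝ (posteriorMean τ ν p.1) (p.1 - p.2) ∂J ≤
      Ent θ + (4 * τ)⁻¹ * ∫ p, ‖p.1 - p.2‖ ^ 2 ∂J := by
  have hp := isProbabilityMeasure_heatFlow hτ ν
  obtain ⟨hJ1, hJ2⟩ := hJ
  have hmν := integrable_norm_sq_heatFlow hτ hν
  have l1 : MemLp (fun p : ℝ² × ℝ² => p.1) 2 J := by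
    rw [memLp_two_iff_integrable_sq_norm (Measurable.aestronglyMeasurable (by fun_prop))]
    rw [← hJ1] at hmν
    exact hmν.comp_measurable measurable_fst
  have l2 : MemLp (fun p : ℝ² × ℝ² => p.2) 2 J := by
    rw [memLp_two_iff_integrable_sq_norm (Measurable.aestronglyMeasurable (by fun_prop))]
    rw [← hJ2] at hm
    exact hm.comp_measurable measurable_snd
  have lb : MemLp (fun p : ℝ² × ℝ² => posteriorMean τ ν p.1) 2 J := by
    have := memLp_posteriorMean hτ ν
    rw [← hJ1] at this
    exact this.comp_of_map (by fun_prop)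
  have i1 := integrable_log_heatDensity hτ ν hmν
  have i2 := integrable_log_heatDensity hτ ν hm
  have hG := integral_log_le_Ent hac hθ (by fun_prop) (fun _ => heatDensity_pos hτ ν _)
    (lintegral_heatDensity hτ ν).le i2
  rw [Ent_heatFlow hτ]
  set g : ℝ² → ℝ := fun p => Real.log (heatDensity τ ν p)
  have hg : Measurable g := by fun_prop
  have e1 : ∫ p, g p ∂(heatFlow τ ν) = ∫ p, g p.1 ∂J := by
    rw [← hJ1, integral_map (by fun_prop) hg.aestronglyMeasurable]
  have e2 : ∫ p, g p ∂θ = ∫ p, g p.2 ∂J := by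
    rw [← hJ2, integral_map (by fun_prop) hg.aestronglyMeasurable]
  have j1 : Integrable (fun p : ℝ² × ℝ² => g p.1) J := by
    rw [← hJ1] at i1; exact i1.comp_measurable measurable_fst
  have j2 : Integrable (fun p : ℝ² × ℝ² => g p.2) J := by
    rw [← hJ2] at i2; exact i2.comp_measurable measurable_snd
  have j3 := (integrable_inner_of_memLp_two lb (l1.sub l2)).const_mul (2 * τ)⁻¹
  have j4 := ((l1.sub l2).integrable_norm_pow two_ne_zero).const_mul (4 * τ)⁻¹
  simp only [Pi.sub_apply] at j3 j4
  have h := integral_mono (j1.add j3) (j2.add j4) (fun p => by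
    have := log_heatDensity_ge hτ ν p.2 p.1
    have e3 : inner ℝ (posteriorMean τ ν p.1) (p.1 - p.2) =
      - inner ℝ (p.2 - p.1) (posteriorMean τ ν p.1) := by
      rw [real_inner_comm, ← inner_neg_left, neg_sub]
    simp only [Pi.add_apply]
    rw [e3, norm_sub_rev p.1 p.2]
    simp only [div_eq_inv_mul] at this
    linarith)
  simp only [Pi.add_apply] at h
  rw [integral_add j1 j3, integral_add j2 j4, integral_const_mul, integral_const_mul] at h
  rw [e1]
  linarith

section Gluing

open ProbabilityTheory

lemma norm_integral_sq_le {Ω F : Type*} [MeasurableSpace Ω] {P : Measure Ω}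
    [IsProbabilityMeasure P] [NormedAddCommGroup F] [InnerProductSpace ℝ F] [CompleteSpace F]
    {d : Ω → F} (hd : MemLp d 2 P) : ‖∫ x, d x ∂P‖ ^ 2 ≤ ∫ x, ‖d x‖ ^ 2 ∂P := by
  have h := integral_norm_add_sq hd (memLp_const (-∫ x, d x ∂P))
  have h0 : 0 ≤ ∫ x, ‖d x + -∫ x, d x ∂P‖ ^ 2 ∂P := integral_nonneg fun _ => sq_nonneg _
  have h1 : ∫ x, inner ℝ (d x) (-∫ x, d x ∂P) ∂P = -‖∫ x, d x ∂P‖ ^ 2 := by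
    simp only [inner_neg_right, integral_neg, real_inner_comm (∫ x, d x ∂P)]
    rw [integral_inner (hd.integrable one_le_two), real_inner_self_eq_norm_sq]
  rw [h, h1] at h0
  simp only [norm_neg, integral_const, probReal_univ, smul_eq_mul, one_mul] at h0
  linarith

lemma integral_inner_compProd {α β F : Type*} [MeasurableSpace α] [MeasurableSpace β]
    [NormedAddCommGroup F] [InnerProductSpace ℝ F] [CompleteSpace F]
    {Q : Measure α} [IsFiniteMeasure Q] {κ : Kernel α β} [IsMarkovKernel κ]
    {h : α → F} {g : α × β → F} (hg : Integrable g (Q ⊗ₘ κ))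
    (hi : Integrable (fun p => inner ℝ (h p.1) (g p)) (Q ⊗ₘ κ)) :
    ∫ p, inner ℝ (h p.1) (g p) ∂(Q ⊗ₘ κ) = ∫ a, inner ℝ (h a) (∫ b, g (a, b) ∂(κ a)) ∂Q := by
  rw [Measure.integral_compProd hi]
  refine integral_congr_ae ?_
  filter_upwards [((Measure.integrable_compProd_iff hg.1).1 hg).1] with a ha
  exact integral_inner ha _

lemma memLp_integral_kernel {α β F : Type*} [MeasurableSpace α] [MeasurableSpace β]
    [NormedAddCommGroup F] [InnerProductSpace ℝ F] [CompleteSpace F]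
    {Q : Measure α} [IsFiniteMeasure Q] {κ : Kernel α β} [IsMarkovKernel κ]
    {g : α × β → F} (hg : MemLp g 2 (Q ⊗ₘ κ)) (hgm : StronglyMeasurable g) :
    MemLp (fun a => ∫ b, g (a, b) ∂(κ a)) 2 Q := by
  have hm : StronglyMeasurable (fun a => ∫ b, g (a, b) ∂(κ a)) :=
    hgm.integral_kernel_prod_right'
  rw [memLp_two_iff_integrable_sq_norm hm.aestronglyMeasurable]
  have h2 := hg.integrable_norm_pow two_ne_zero
  refine (Measure.integrable_compProd_iff h2.1 |>.1 h2).2.mono'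
    (hm.norm.pow 2).aestronglyMeasurable ?_
  filter_upwards [(Measure.integrable_compProd_iff h2.1 |>.1 h2).1] with a ha
  have hga : MemLp (fun b => g (a, b)) 2 (κ a) :=
    (memLp_two_iff_integrable_sq_norm
      (hgm.comp_measurable measurable_prodMk_left).aestronglyMeasurable).2 ha
  simpa using norm_integral_sq_le hga

lemma IsCoupling.isProbabilityMeasure {Y : Type*} [MeasurableSpace Y] {μ ν : Measure Y}
    [hμ : IsProbabilityMeasure μ] {J : Measure (Y × Y)} (hJ : IsCoupling J μ ν) :
    IsProbabilityMeasure J := by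
  rw [← hJ.1] at hμ
  exact Measure.isProbabilityMeasure_of_map (Prod.fst : Y × Y → Y)

lemma IsCoupling.memLp_fst_comp {F G : Type*} [MeasurableSpace G] [NormedAddCommGroup F]
    {μ ν : Measure G} {J : Measure (G × G)}
    (hJ : IsCoupling J μ ν) {f : G → F} (hf : MemLp f 2 μ) : MemLp (fun p => f p.1) 2 J := by
  rw [← hJ.1] at hf
  exact hf.comp_of_map measurable_fst.aemeasurable

lemma IsCoupling.memLp_snd_comp {F G : Type*} [MeasurableSpace G] [NormedAddCommGroup F]
    {μ ν : Measure G} {J : Measure (G × G)}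
    (hJ : IsCoupling J μ ν) {f : G → F} (hf : MemLp f 2 ν) : MemLp (fun p => f p.2) 2 J := by
  rw [← hJ.2] at hf
  exact hf.comp_of_map measurable_snd.aemeasurable

lemma IsCoupling.memLp_sub {F : Type*} [MeasurableSpace F] [NormedAddCommGroup F]
    {μ ν : Measure F} {J : Measure (F × F)} (hJ : IsCoupling J μ ν)
    (hμ : MemLp id 2 μ) (hν : MemLp id 2 ν) : MemLp (fun p : F × F => p.1 - p.2) 2 J :=
  (hJ.memLp_fst_comp hμ).sub (hJ.memLp_snd_comp hν)

lemma map_compProd_prodMkRight {α β γ : Type*} [MeasurableSpace α] [MeasurableSpace β]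
    [MeasurableSpace γ] (Q : Measure (α × γ)) [IsFiniteMeasure Q] (κ : Kernel α β)
    [IsMarkovKernel κ] :
    (Q ⊗ₘ κ.prodMkRight γ).map (fun p => (p.1.1, p.2)) = Q.fst ⊗ₘ κ := by
  ext s hs
  have hg : Measurable fun p : (α × γ) × β => (p.1.1, p.2) := by fun_prop
  rw [Measure.map_apply hg hs, Measure.compProd_apply (hg hs), Measure.compProd_apply hs,
    Measure.fst, lintegral_map (Kernel.measurable_kernel_prodMk_left hs) measurable_fst]
  rfl

/-- Gluing a coupling `J` of `(ν', ν)` to couplings of `(ν', θ)`, conditionally independently given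
`ν'`; here `m` is the conditional expectation of `p.1 - p.2` under `J` given `p.1`. -/
lemma exists_condMean_glue {F : Type*} [NormedAddCommGroup F] [InnerProductSpace ℝ F]
    [FiniteDimensional ℝ F] [MeasurableSpace F] [BorelSpace F]
    {ν' ν : Measure F} [IsProbabilityMeasure ν'] {J : Measure (F × F)} (hJ : IsCoupling J ν' ν)
    (hν' : MemLp id 2 ν') (hν : MemLp id 2 ν) :
    ∃ m : F → F, Measurable m ∧ MemLp m 2 ν' ∧
      (∀ f : F → F, MemLp f 2 ν' →
        ∫ z, inner ℝ (f z) (m z) ∂ν' = ∫ p, inner ℝ (f p.1) (p.1 - p.2) ∂J) ∧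
      ∀ (θ : Measure F) (Q : Measure (F × F)), MemLp id 2 θ → IsCoupling Q ν' θ →
        ∃ Q' : Measure (F × F), IsCoupling Q' ν θ ∧
          ∫ p, ‖p.1 - p.2‖ ^ 2 ∂Q' ≤
            (√(∫ p, ‖p.1 - p.2‖ ^ 2 ∂Q) + √(∫ z, ‖m z‖ ^ 2 ∂ν')) ^ 2
              + ∫ p, ‖p.1 - p.2‖ ^ 2 ∂J := by
  have hJp := hJ.isProbabilityMeasure
  have : ProperSpace F := FiniteDimensional.proper ℝ F
  set κ := J.condKernel
  have hJκ : ν' ⊗ₘ κ = J := by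
    have := J.disintegrate J.condKernel
    rwa [Measure.fst, hJ.1] at this
  have hd := hJ.memLp_sub hν' hν
  have hdκ : MemLp (fun p : F × F => p.1 - p.2) 2 (ν' ⊗ₘ κ) := by rwa [hJκ]
  have hsm : StronglyMeasurable (fun p : F × F => p.1 - p.2) := by fun_prop
  have hm := memLp_integral_kernel hdκ hsm
  have hmm : StronglyMeasurable (fun a => ∫ b, (a - b) ∂(κ a)) :=
    hsm.integral_kernel_prod_right'
  refine ⟨fun z => ∫ y, (z - y) ∂(κ z), hmm.measurable, hm, fun f hf => ?_, fun θ Q hθ hQ => ?_⟩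
  · have := integral_inner_compProd (Q := ν') (κ := κ) (h := f) (hdκ.integrable one_le_two)
      (by rw [hJκ]; exact integrable_inner_of_memLp_two (hJ.memLp_fst_comp hf) hd)
    rw [hJκ] at this
    exact this.symm
  · have hQp := hQ.isProbabilityMeasure
    set P := Q ⊗ₘ κ.prodMkRight F with hP
    have hR1 : P.map Prod.fst = Q := Measure.fst_compProd Q _
    have hRJ : P.map (fun p => (p.1.1, p.2)) = J := by
      rw [hP, map_compProd_prodMkRight, Measure.fst, hQ.1, hJκ]
    have hw := hQ.memLp_sub hν' hθ
    have hwR : MemLp (fun p : (F × F) × F => p.1.2 - p.1.1) 2 P := by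
      have h := hw.neg
      rw [← hR1] at h
      simpa only [Function.comp_def, Pi.neg_def, neg_sub] using h.comp_of_map measurable_fst.aemeasurable
    have hdR : MemLp (fun p : (F × F) × F => p.1.1 - p.2) 2 P := by
      rw [← hRJ] at hd
      exact hd.comp_of_map (by fun_prop)
    refine ⟨P.map (fun p => (p.2, p.1.2)), ⟨?_, ?_⟩, ?_⟩
    · rw [Measure.map_map measurable_fst (by fun_prop), ← hJ.2, ← hRJ,
        Measure.map_map measurable_snd (by fun_prop)]
      rfl
    · rw [Measure.map_map measurable_snd (by fun_prop), ← hQ.2, ← hR1,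
        Measure.map_map measurable_snd (by fun_prop)]
      rfl
    · have e1 : ∫ p, ‖p.1 - p.2‖ ^ 2 ∂(P.map (fun p => (p.2, p.1.2))) =
          ∫ p : (F × F) × F, ‖(p.1.2 - p.1.1) + (p.1.1 - p.2)‖ ^ 2 ∂P := by
        rw [integral_map (by fun_prop) (by fun_prop)]
        refine integral_congr_ae (Filter.Eventually.of_forall fun p => ?_)
        simp only [sub_add_sub_cancel]
        rw [norm_sub_rev]
      have e2 : ∫ p : (F × F) × F, ‖p.1.2 - p.1.1‖ ^ 2 ∂P = ∫ p, ‖p.1 - p.2‖ ^ 2 ∂Q := by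
        conv_rhs => rw [← hR1]
        rw [integral_map (by fun_prop) (by fun_prop)]
        simp only [norm_sub_rev]
      have e3 : ∫ p : (F × F) × F, ‖p.1.1 - p.2‖ ^ 2 ∂P = ∫ p, ‖p.1 - p.2‖ ^ 2 ∂J := by
        conv_rhs => rw [← hRJ]
        rw [integral_map (by fun_prop) (by fun_prop)]
      have e4 : ∫ p : (F × F) × F, inner ℝ (p.1.2 - p.1.1) (p.1.1 - p.2) ∂P =
          ∫ p : F × F, inner ℝ (p.2 - p.1) (∫ y, (p.1 - y) ∂(κ p.1)) ∂Q :=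
        integral_inner_compProd (h := fun p : F × F => p.2 - p.1)
          (g := fun p : (F × F) × F => p.1.1 - p.2) (hdR.integrable one_le_two)
          (integrable_inner_of_memLp_two hwR hdR)
      have hw' : MemLp (fun p : F × F => p.2 - p.1) 2 Q := by
        have h := hw.neg
        simpa only [Pi.neg_def, neg_sub] using h
      have e5 := integral_inner_le_sqrt_mul_sqrt hw' (hQ.memLp_fst_comp hm)
      have e6 : ∫ p, ‖∫ y, (p.1 - y) ∂(κ p.1)‖ ^ 2 ∂Q = ∫ z, ‖∫ y, (z - y) ∂(κ z)‖ ^ 2 ∂ν' := by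
        conv_rhs => rw [← hQ.1]
        exact (integral_map measurable_fst.aemeasurable
          (hmm.norm.pow 2).aestronglyMeasurable).symm
      have e7 : ∫ p, ‖p.2 - p.1‖ ^ 2 ∂Q = ∫ p, ‖p.1 - p.2‖ ^ 2 ∂Q := by
        simp only [norm_sub_rev]
      rw [e6, e7] at e5
      rw [e1, integral_norm_add_sq hwR hdR, e2, e3, e4, add_sq,
        Real.sq_sqrt (integral_nonneg fun _ => sq_nonneg _),
        Real.sq_sqrt (integral_nonneg fun _ => sq_nonneg _)]
      have : 0 ≤ ∫ z, ‖∫ y, (z - y) ∂(κ z)‖ ^ 2 ∂ν' := integral_nonneg fun _ => sq_nonneg _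
      linarith

end Gluing

section Step

variable {Ω : Type*} [MeasurableSpace Ω] {π : Measure Ω}

lemma map_comp_add_smul_prod_stdHeat [IsProbabilityMeasure π] {q : Ω → ℝ²} (hq : Measurable q)
    {τ : ℝ} (hτ : 0 < τ) :
    (π.prod stdHeat).map (fun p => q p.1 + √τ • p.2) = heatFlow τ (π.map q) := by
  have := Measure.isProbabilityMeasure_map hq.aemeasurable (μ := π)
  rw [← map_add_smul_prod_stdHeat hτ, ← Measure.map_id (μ := stdHeat),
    Measure.map_prod_map _ _ hq measurable_id, Measure.map_map (by fun_prop) (by fun_prop),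
    Measure.map_id]
  rfl

lemma integral_inner_posteriorMean_map [IsProbabilityMeasure π] {q : Ω → ℝ²} (hq : Measurable q)
    {τ : ℝ} (hτ : 0 < τ) {f : ℝ² → ℝ²} (hf : MemLp f 2 (heatFlow τ (π.map q)))
    (hfm : Measurable f) :
    ∫ z, inner ℝ (f z) (posteriorMean τ (π.map q) z) ∂(heatFlow τ (π.map q)) =
      √τ * ∫ p, inner ℝ (f (q p.1 + √τ • p.2)) p.2 ∂(π.prod stdHeat) := by
  have := Measure.isProbabilityMeasure_map hq.aemeasurable (μ := π)
  rw [integral_inner_posteriorMean hτ _ hf hfm, ← Measure.map_id (μ := stdHeat),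
    Measure.map_prod_map _ _ hq measurable_id, integral_map (by fun_prop) (by fun_prop),
    Measure.map_id]
  rfl

lemma memLp_two_id_iff {ν : Measure ℝ²} : MemLp id 2 ν ↔ Integrable (fun x => ‖x‖ ^ 2) ν :=
  memLp_two_iff_integrable_sq_norm (by fun_prop)

lemma memLp_snd_prod_stdHeat [IsProbabilityMeasure π] :
    MemLp (fun p : Ω × ℝ² => p.2) 2 (π.prod stdHeat) :=
  (memLp_two_id_iff.2 integrable_norm_sq_stdHeat).comp_measurePreserving measurePreserving_snd

lemma memLp_comp_fst_prod_stdHeat {F : Type*} [NormedAddCommGroup F] {q : Ω → F}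
    (hq : MemLp q 2 π) : MemLp (fun p : Ω × ℝ² => q p.1) 2 (π.prod stdHeat) :=
  hq.comp_measurePreserving measurePreserving_fst

/-- `θ` can be reached from `ν` by a coupling of quadratic cost at most `r ^ 2`. -/
def CoupledWithin (ν θ : Measure ℝ²) (r : ℝ) : Prop :=
  ∃ Q : Measure (ℝ² × ℝ²), IsCoupling Q ν θ ∧ ∫ p, ‖p.1 - p.2‖ ^ 2 ∂Q ≤ r ^ 2

lemma memLp_id_heatFlow_map [IsProbabilityMeasure π] {q : Ω → ℝ²} (hq : Measurable q)
    (hq2 : MemLp q 2 π) {τ : ℝ} (hτ : 0 < τ) : MemLp id 2 (heatFlow τ (π.map q)) := by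
  rw [← map_comp_add_smul_prod_stdHeat hq hτ,
    memLp_map_measure_iff (by fun_prop) (by fun_prop)]
  exact (memLp_comp_fst_prod_stdHeat hq2).add (memLp_snd_prod_stdHeat.const_smul (√τ))

lemma exists_heatFlow_step [IsProbabilityMeasure π] {q' q : Ω → ℝ²} (hq'm : Measurable q')
    (hqm : Measurable q) (hq' : MemLp q' 2 π) (hq : MemLp q 2 π) {τ' τ : ℝ} (hτ : 0 < τ)
    (hττ' : τ ≤ τ') :
    ∃ α, 0 ≤ α ∧
      α ^ 2 + 2 * (τ' - τ) * (Ent (heatFlow τ' (π.map q')) - Ent (heatFlow τ (π.map q))) ≤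
        ∫ p, ‖(q' p.1 - q p.1) + ((√τ' - √τ) ^ 2 / (2 * √τ')) • p.2‖ ^ 2 ∂(π.prod stdHeat) +
        (τ' - τ) / (2 * τ') *
          ∫ p, ‖(q' p.1 - q p.1) + (√τ' - √τ) • p.2‖ ^ 2 ∂(π.prod stdHeat) ∧
      ∀ (θ : Measure ℝ²) (r : ℝ), MemLp id 2 θ → 0 ≤ r →
        CoupledWithin (heatFlow τ' (π.map q')) θ r →
        CoupledWithin (heatFlow τ (π.map q)) θ
          √((r + α) ^ 2 + ∫ p, ‖(q' p.1 - q p.1) + (√τ' - √τ) • p.2‖ ^ 2 ∂(π.prod stdHeat)) := by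
  have hτ' : 0 < τ' := hτ.trans_le hττ'
  have hp' := Measure.isProbabilityMeasure_map hq'm.aemeasurable (μ := π)
  have hp := Measure.isProbabilityMeasure_map hqm.aemeasurable (μ := π)
  have hfp' := isProbabilityMeasure_heatFlow hτ' (π.map q')
  have hfp := isProbabilityMeasure_heatFlow hτ (π.map q)
  have hm' := memLp_id_heatFlow_map hq'm hq' hτ'
  have hm := memLp_id_heatFlow_map hqm hq hτ
  have hq'2 : Integrable (fun x => ‖x‖ ^ 2) (π.map q') :=
    memLp_two_id_iff.1 ((memLp_map_measure_iff (by fun_prop) (by fun_prop)).2 hq')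
  have hq2 : Integrable (fun x => ‖x‖ ^ 2) (π.map q) :=
    memLp_two_id_iff.1 ((memLp_map_measure_iff (by fun_prop) (by fun_prop)).2 hq)
  set ν' := heatFlow τ' (π.map q') with hν'
  set ν := heatFlow τ (π.map q) with hν
  set P := π.prod stdHeat with hP
  set Y' : Ω × ℝ² → ℝ² := fun p => q' p.1 + √τ' • p.2 with hY'
  set Y : Ω × ℝ² → ℝ² := fun p => q p.1 + √τ • p.2 with hY
  have hY'm : Measurable Y' := by fun_prop
  have hYm : Measurable Y := by fun_prop
  have hY'law : P.map Y' = ν' := map_comp_add_smul_prod_stdHeat hq'm hτ'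
  have hYlaw : P.map Y = ν := map_comp_add_smul_prod_stdHeat hqm hτ
  have hJ : IsCoupling (P.map fun p => (Y' p, Y p)) ν' ν := by
    constructor
    · rw [Measure.map_map measurable_fst (by fun_prop), ← hY'law]; rfl
    · rw [Measure.map_map measurable_snd (by fun_prop), ← hYlaw]; rfl
  have hw : MemLp (fun p : Ω × ℝ² => p.2) 2 P := memLp_snd_prod_stdHeat
  have hD : MemLp (fun p : Ω × ℝ² => q' p.1 - q p.1) 2 P :=
    memLp_comp_fst_prod_stdHeat (hq'.sub hq)
  set e := ∫ p, ‖(q' p.1 - q p.1) + (√τ' - √τ) • p.2‖ ^ 2 ∂P with he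
  set c := (√τ' - √τ) ^ 2 / (2 * √τ') with hc
  have hΔ : ∀ p, Y' p - Y p = (q' p.1 - q p.1) + (√τ' - √τ) • p.2 := fun p => by
    simp only [hY', hY, sub_smul]; abel
  have heJ : ∫ p, ‖p.1 - p.2‖ ^ 2 ∂(P.map fun p => (Y' p, Y p)) = e := by
    rw [integral_map (by fun_prop) (by fun_prop)]
    simp only [hΔ, he]
  obtain ⟨m, hmm, hmL, hminner, hglue⟩ := exists_condMean_glue hJ hm' hm
  have hminner' : ∀ f : ℝ² → ℝ², Measurable f → MemLp f 2 ν' → ∫ z, inner ℝ (f z) (m z) ∂ν' =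
      ∫ p, inner ℝ (f (Y' p)) ((q' p.1 - q p.1) + (√τ' - √τ) • p.2) ∂P := fun f hfm hf => by
    rw [hminner f hf, integral_map (by fun_prop) (by fun_prop)]
    simp only [hΔ]
  set B := posteriorMean τ' (π.map q') with hB
  have hBm : Measurable B := measurable_posteriorMean _ _
  have hBL : MemLp B 2 ν' := memLp_posteriorMean hτ' _
  set l := -((τ' - τ) / (2 * τ')) with hl
  have hent : Ent ν' + (2 * τ')⁻¹ * ∫ z, inner ℝ (B z) (m z) ∂ν' ≤ Ent ν + (4 * τ')⁻¹ * e := by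
    rw [hminner B hBL, ← heJ]
    exact Ent_heatFlow_le_of_coupling hτ' hq'2 (heatFlow_absolutelyContinuous hτ _)
      (integrable_log_rnDeriv_heatFlow hτ hq2) (memLp_two_id_iff.1 hm) hJ
  have hfm : Measurable fun z => m z + l • B z := by fun_prop
  have hlB : MemLp (fun z => l • B z) 2 ν' := hBL.const_smul l
  have hf : MemLp (fun z => m z + l • B z) 2 ν' := hmL.add hlB
  have hcw : MemLp (fun p : Ω × ℝ² => c • p.2) 2 P := hw.const_smul c
  have hE : MemLp (fun p : Ω × ℝ² => (q' p.1 - q p.1) + c • p.2) 2 P := hD.add hcw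
  have hfY : MemLp (fun p => m (Y' p) + l • B (Y' p)) 2 P := by
    rw [← hY'law] at hf
    exact hf.comp_of_map hY'm.aemeasurable
  have hM : ∫ z, ‖m z + l • B z‖ ^ 2 ∂ν' =
      ∫ p, inner ℝ (m (Y' p) + l • B (Y' p)) ((q' p.1 - q p.1) + c • p.2) ∂P := by
    have h1 : ∫ z, ‖m z + l • B z‖ ^ 2 ∂ν' = ∫ z, inner ℝ (m z + l • B z) (m z) ∂ν' +
        l * ∫ z, inner ℝ (m z + l • B z) (B z) ∂ν' := by
      rw [← integral_const_mul, ← integral_add (integrable_inner_of_memLp_two hf hmL)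
        ((integrable_inner_of_memLp_two hf hBL).const_mul l)]
      simp only [← real_inner_self_eq_norm_sq, ← real_inner_smul_right, ← inner_add_right]
    have h2 : ∫ z, inner ℝ (m z + l • B z) (B z) ∂ν' =
        √τ' * ∫ p, inner ℝ (m (Y' p) + l • B (Y' p)) p.2 ∂P :=
      integral_inner_posteriorMean_map hq'm hτ' hf hfm
    have hDw : MemLp (fun p : Ω × ℝ² => (q' p.1 - q p.1) + (√τ' - √τ) • p.2) 2 P :=
      hD.add (hw.const_smul (√τ' - √τ))
    rw [h1, h2, hminner' _ hfm hf, ← mul_assoc, ← integral_const_mul,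
      ← integral_add (integrable_inner_of_memLp_two hfY hDw)
        ((integrable_inner_of_memLp_two hfY hw).const_mul _)]
    refine integral_congr_ae (Filter.Eventually.of_forall fun p => ?_)
    have hcl : √τ' - √τ + l * √τ' = c := by
      have h3 := Real.sq_sqrt hτ'.le
      have h4 := Real.sq_sqrt hτ.le
      have h5 : 0 < √τ' := Real.sqrt_pos.2 hτ'
      rw [hl, hc]
      field_simp
      rw [← h3, ← h4]
      simp only [Real.sqrt_sq (Real.sqrt_nonneg _)]
      field_simp
      ring
    simp only [← real_inner_smul_right, ← inner_add_right]
    rw [add_assoc, ← add_smul, hcl]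
  have hM0 : 0 ≤ ∫ z, ‖m z + l • B z‖ ^ 2 ∂ν' := integral_nonneg fun _ => sq_nonneg _
  have hE0 : 0 ≤ ∫ p, ‖(q' p.1 - q p.1) + c • p.2‖ ^ 2 ∂P := integral_nonneg fun _ => sq_nonneg _
  have hME : ∫ z, ‖m z + l • B z‖ ^ 2 ∂ν' ≤ ∫ p, ‖(q' p.1 - q p.1) + c • p.2‖ ^ 2 ∂P := by
    have h1 := integral_inner_le_sqrt_mul_sqrt hfY hE
    have h2 : ∫ p, ‖m (Y' p) + l • B (Y' p)‖ ^ 2 ∂P = ∫ z, ‖m z + l • B z‖ ^ 2 ∂ν' := by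
      rw [← hY'law, integral_map (by fun_prop) (by fun_prop)]
    rw [← hM, h2] at h1
    nlinarith [Real.sq_sqrt hM0, Real.sq_sqrt hE0, Real.sqrt_nonneg (∫ z, ‖m z + l • B z‖ ^ 2 ∂ν'),
      Real.sqrt_nonneg (∫ p, ‖(q' p.1 - q p.1) + c • p.2‖ ^ 2 ∂P),
      sq_nonneg (√(∫ z, ‖m z + l • B z‖ ^ 2 ∂ν') - √(∫ p, ‖(q' p.1 - q p.1) + c • p.2‖ ^ 2 ∂P))]
  have hα : 0 ≤ ∫ z, ‖m z‖ ^ 2 ∂ν' := integral_nonneg fun _ => sq_nonneg _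
  refine ⟨√(∫ z, ‖m z‖ ^ 2 ∂ν'), Real.sqrt_nonneg _, ?_, fun θ r hθ hr ⟨Q, hQ, hQr⟩ => ?_⟩
  · rw [Real.sq_sqrt hα]
    have h3 := integral_norm_add_sq hmL hlB
    have h4 : ∫ z, inner ℝ (m z) (l • B z) ∂ν' = l * ∫ z, inner ℝ (B z) (m z) ∂ν' := by
      rw [← integral_const_mul]
      simp only [real_inner_smul_right, real_inner_comm]
    rw [h4] at h3
    have h5 : 0 ≤ ∫ z, ‖l • B z‖ ^ 2 ∂ν' := integral_nonneg fun _ => sq_nonneg _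
    have h6 := mul_le_mul_of_nonneg_left hent (by linarith : 0 ≤ 2 * (τ' - τ))
    have h7 : 2 * (τ' - τ) * (Ent ν' + (2 * τ')⁻¹ * ∫ z, inner ℝ (B z) (m z) ∂ν') =
        2 * (τ' - τ) * Ent ν' - 2 * (l * ∫ z, inner ℝ (B z) (m z) ∂ν') := by
      rw [hl]; field_simp; ring
    have h8 : 2 * (τ' - τ) * (Ent ν + (4 * τ')⁻¹ * e) =
        2 * (τ' - τ) * Ent ν + (τ' - τ) / (2 * τ') * e := by
      field_simp; ring
    linarith
  · obtain ⟨Q', hQ', hle⟩ := hglue θ Q hθ hQ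
    rw [heJ] at hle
    have he0 : 0 ≤ e := integral_nonneg fun _ => sq_nonneg _
    refine ⟨Q', hQ', ?_⟩
    rw [Real.sq_sqrt (by positivity)]
    refine hle.trans ?_
    have : √(∫ p, ‖p.1 - p.2‖ ^ 2 ∂Q) ≤ r := Real.sqrt_le_iff.2 ⟨hr, hQr⟩
    gcongr

end Step

section Chain

lemma CoupledWithin.mono {ν θ : Measure ℝ²} {r s : ℝ} (h : CoupledWithin ν θ r) (hr : 0 ≤ r)
    (hrs : r ≤ s) : CoupledWithin ν θ s := by
  obtain ⟨Q, hQ, hle⟩ := h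
  exact ⟨Q, hQ, hle.trans (by gcongr)⟩

lemma integral_norm_add_sq_le {Ω F : Type*} [MeasurableSpace Ω] {P : Measure Ω}
    [NormedAddCommGroup F] [InnerProductSpace ℝ F] {f g : Ω → F} (hf : MemLp f 2 P)
    (hg : MemLp g 2 P) {h : ℝ} (hh : 0 < h) :
    ∫ x, ‖f x + g x‖ ^ 2 ∂P ≤
      (1 + h) * ∫ x, ‖f x‖ ^ 2 ∂P + (1 + h⁻¹) * ∫ x, ‖g x‖ ^ 2 ∂P := by
  rw [← integral_const_mul, ← integral_const_mul, ← integral_add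
    ((hf.integrable_norm_pow two_ne_zero).const_mul _)
    ((hg.integrable_norm_pow two_ne_zero).const_mul _)]
  refine integral_mono ((hf.add hg).integrable_norm_pow two_ne_zero)
    (((hf.integrable_norm_pow two_ne_zero).const_mul _).add
    ((hg.integrable_norm_pow two_ne_zero).const_mul _)) fun x => ?_
  have h1 := norm_add_le (f x) (g x)
  have h2 : ‖f x + g x‖ ^ 2 ≤ (‖f x‖ + ‖g x‖) ^ 2 := by gcongr
  have h3 : 2 * (‖f x‖ * ‖g x‖) ≤ h * ‖f x‖ ^ 2 + h⁻¹ * ‖g x‖ ^ 2 := by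
    have : h * ‖f x‖ ^ 2 + h⁻¹ * ‖g x‖ ^ 2 - 2 * (‖f x‖ * ‖g x‖) =
        h⁻¹ * (h * ‖f x‖ - ‖g x‖) ^ 2 := by field_simp; ring
    have : 0 ≤ h⁻¹ * (h * ‖f x‖ - ‖g x‖) ^ 2 := by positivity
    linarith
  simp only
  nlinarith

lemma integral_norm_smul_sq {Ω F : Type*} [MeasurableSpace Ω] {P : Measure Ω}
    [NormedAddCommGroup F] [NormedSpace ℝ F] (c : ℝ) (f : Ω → F) :
    ∫ x, ‖c • f x‖ ^ 2 ∂P = c ^ 2 * ∫ x, ‖f x‖ ^ 2 ∂P := by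
  rw [← integral_const_mul]
  simp only [norm_smul, mul_pow, Real.norm_eq_abs, sq_abs]

/-- The displacement interpolation associated to pairs `(x, y)`, at `y` for `s = 0` and at `x` for
`s = 1`. -/
def segmentPoint (s : ℝ) (p : ℝ² × ℝ²) : ℝ² := p.2 + s • (p.1 - p.2)

@[fun_prop]
lemma measurable_segmentPoint (s : ℝ) : Measurable (segmentPoint s) := by
  unfold segmentPoint; fun_prop

lemma memLp_segmentPoint {μ χ : Measure ℝ²} {π : Measure (ℝ² × ℝ²)} (hπ : IsCoupling π μ χ)
    (hμ : MemLp id 2 μ) (hχ : MemLp id 2 χ) (s : ℝ) : MemLp (segmentPoint s) 2 π :=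
  (hπ.memLp_snd_comp hχ).add ((hπ.memLp_sub hμ hχ).const_smul s)

lemma sqrt_sub_sqrt_le {ε a b : ℝ} (hε : 0 < ε) (ha : ε ≤ a) (hab : a ≤ b) :
    √b - √a ≤ (b - a) / √ε := by
  have h0 : 0 < √ε := Real.sqrt_pos.2 hε
  have h1 : √ε ≤ √a := Real.sqrt_le_sqrt ha
  have h2 : √a ≤ √b := Real.sqrt_le_sqrt hab
  rw [le_div_iff₀ h0]
  nlinarith [Real.sq_sqrt (hε.le.trans ha), Real.sq_sqrt (hε.le.trans (ha.trans hab))]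

lemma exists_heatFlow_segment_step {μ χ : Measure ℝ²} [IsProbabilityMeasure μ]
    {π : Measure (ℝ² × ℝ²)} (hπ : IsCoupling π μ χ) (hμ : MemLp id 2 μ) (hχ : MemLp id 2 χ)
    {t ε : ℝ} (ht : 0 < t) (hε : 0 < ε) :
    ∃ C E : ℝ, 0 ≤ C ∧ 0 ≤ E ∧ ∀ s h : ℝ, 0 ≤ s → 0 < h → h ≤ 1 → ∃ α, 0 ≤ α ∧
      α ^ 2 + 2 * t * h * (Ent (heatFlow (ε + t * (s + h)) (π.map (segmentPoint (s + h)))) -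
          Ent (heatFlow (ε + t * s) (π.map (segmentPoint s)))) ≤
        h ^ 2 * ∫ p, ‖p.1 - p.2‖ ^ 2 ∂π + C * h ^ 3 ∧
      ∀ (θ : Measure ℝ²) (r : ℝ), MemLp id 2 θ → 0 ≤ r →
        CoupledWithin (heatFlow (ε + t * (s + h)) (π.map (segmentPoint (s + h)))) θ r →
        CoupledWithin (heatFlow (ε + t * s) (π.map (segmentPoint s))) θ
          √((r + α) ^ 2 + E * h ^ 2) := by
  have hπp := hπ.isProbabilityMeasure
  set K := ∫ p, ‖p.1 - p.2‖ ^ 2 ∂π with hK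
  set Γ := ∫ w, ‖w‖ ^ 2 ∂stdHeat with hΓ
  have hK0 : 0 ≤ K := integral_nonneg fun _ => sq_nonneg _
  have hΓ0 : 0 ≤ Γ := integral_nonneg fun _ => sq_nonneg _
  set E := 2 * K + 2 * (t ^ 2 / ε) * Γ with hE
  have hE0 : 0 ≤ E := by positivity
  refine ⟨K + 2 * (t ^ 4 / ε ^ 3) * Γ + t / (2 * ε) * E, E, by positivity, hE0,
    fun s h hs hh hh1 => ?_⟩
  have hτ : 0 < ε + t * s := by positivity
  have hτε : ε ≤ ε + t * s := by nlinarith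
  have hττ' : ε + t * s ≤ ε + t * (s + h) := by nlinarith
  obtain ⟨α, hα, hα1, hα2⟩ := exists_heatFlow_step (measurable_segmentPoint (s + h))
    (measurable_segmentPoint s) (memLp_segmentPoint hπ hμ hχ (s + h))
    (memLp_segmentPoint hπ hμ hχ s) hτ hττ'
  have hD : ∀ p, segmentPoint (s + h) p - segmentPoint s p = h • (p.1 - p.2) := fun p => by
    simp only [segmentPoint, add_smul]; abel
  have hth : ε + t * (s + h) - (ε + t * s) = t * h := by ring
  have hδ := sqrt_sub_sqrt_le hε hτε hττ'
  have hδ0 : 0 ≤ √(ε + t * (s + h)) - √(ε + t * s) := sub_nonneg.2 (Real.sqrt_le_sqrt hττ')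
  have hu' : √ε ≤ √(ε + t * (s + h)) := Real.sqrt_le_sqrt (hτε.trans hττ')
  have hτ'ε : ε ≤ ε + t * (s + h) := hτε.trans hττ'
  have hε0 : 0 < √ε := Real.sqrt_pos.2 hε
  simp only [hD, hth] at hα1 hα2 hδ
  set δ := √(ε + t * (s + h)) - √(ε + t * s) with hδdef
  set c := δ ^ 2 / (2 * √(ε + t * (s + h))) with hc
  have hδ2 : δ ^ 2 ≤ t ^ 2 / ε * h ^ 2 := by
    calc δ ^ 2 ≤ (t * h / √ε) ^ 2 := by gcongr
      _ = t ^ 2 / ε * h ^ 2 := by rw [div_pow, Real.sq_sqrt hε.le]; ring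
  have hc0 : 0 ≤ c := by positivity
  have hc1 : c ^ 2 ≤ t ^ 4 / ε ^ 3 * h ^ 4 := by
    have h1 : c ≤ t ^ 2 / ε * h ^ 2 / √ε := by
      rw [hc]
      gcongr
      linarith
    calc c ^ 2 ≤ (t ^ 2 / ε * h ^ 2 / √ε) ^ 2 := by gcongr
      _ = t ^ 4 / ε ^ 3 * h ^ 4 := by rw [div_pow, Real.sq_sqrt hε.le]; field_simp
  have hDL : MemLp (fun p : (ℝ² × ℝ²) × ℝ² => h • (p.1.1 - p.1.2)) 2 (π.prod stdHeat) :=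
    (memLp_comp_fst_prod_stdHeat (hπ.memLp_sub hμ hχ)).const_smul h
  have hwL : ∀ a : ℝ, MemLp (fun p : (ℝ² × ℝ²) × ℝ² => a • p.2) 2 (π.prod stdHeat) :=
    fun a => memLp_snd_prod_stdHeat.const_smul a
  have hDi : ∫ p, ‖h • (p.1.1 - p.1.2)‖ ^ 2 ∂(π.prod stdHeat) = h ^ 2 * K := by
    rw [integral_norm_smul_sq, hK,
      integral_fun_fst (μ := π) (ν := stdHeat) (fun p : ℝ² × ℝ² => ‖p.1 - p.2‖ ^ 2)]
    simp
  have hwi : ∀ a : ℝ, ∫ p : (ℝ² × ℝ²) × ℝ², ‖a • p.2‖ ^ 2 ∂(π.prod stdHeat) = a ^ 2 * Γ :=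
    fun a => by
      rw [integral_norm_smul_sq, hΓ, integral_fun_snd (μ := π) (ν := stdHeat) (fun w => ‖w‖ ^ 2)]
      simp
  have hb1 := integral_norm_add_sq_le hDL (hwL c) hh
  have hb2 := integral_norm_add_sq_le hDL (hwL δ) one_pos
  rw [hDi, hwi] at hb1 hb2
  have he : ∫ p, ‖h • (p.1.1 - p.1.2) + δ • p.2‖ ^ 2 ∂(π.prod stdHeat) ≤ E * h ^ 2 := by
    have := mul_le_mul_of_nonneg_right hδ2 hΓ0
    calc _ ≤ _ := hb2
      _ ≤ (1 + 1) * (h ^ 2 * K) + (1 + 1⁻¹) * (t ^ 2 / ε * h ^ 2 * Γ) := by gcongr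
      _ = E * h ^ 2 := by rw [hE]; ring
  have he0 : 0 ≤ ∫ p, ‖h • (p.1.1 - p.1.2) + δ • p.2‖ ^ 2 ∂(π.prod stdHeat) :=
    integral_nonneg fun _ => sq_nonneg _
  refine ⟨α, hα, ?_, fun θ r hθ hr hc => ?_⟩
  · have h1 : t * h / (2 * (ε + t * (s + h))) *
        ∫ p, ‖h • (p.1.1 - p.1.2) + δ • p.2‖ ^ 2 ∂(π.prod stdHeat) ≤
        t * h / (2 * ε) * (E * h ^ 2) := by gcongr
    have h2 : (1 + h⁻¹) * (c ^ 2 * Γ) ≤ (2 * h⁻¹) * (t ^ 4 / ε ^ 3 * h ^ 4 * Γ) := by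
      have : 1 ≤ h⁻¹ := (one_le_inv₀ hh).2 hh1
      gcongr
      linarith
    have h3 : (2 * h⁻¹) * (t ^ 4 / ε ^ 3 * h ^ 4 * Γ) = 2 * (t ^ 4 / ε ^ 3) * Γ * h ^ 3 := by
      field_simp
    have h4 : t * h / (2 * ε) * (E * h ^ 2) = t / (2 * ε) * E * h ^ 3 := by ring
    rw [h3] at h2
    rw [h4] at h1
    linarith
  · refine (hα2 θ r hθ hr hc).mono (Real.sqrt_nonneg _) (Real.sqrt_le_sqrt ?_)
    linarith

lemma exists_chain {μ χ : Measure ℝ²} [IsProbabilityMeasure μ]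
    {π : Measure (ℝ² × ℝ²)} (hπ : IsCoupling π μ χ) (hμ : MemLp id 2 μ) (hχ : MemLp id 2 χ)
    {t ε : ℝ} (ht : 0 < t) (hε : 0 < ε) {θ : Measure ℝ²} (hθ : MemLp id 2 θ) {r : ℝ} (hr : 0 ≤ r)
    (hstart : CoupledWithin (heatFlow (ε + t) μ) θ r) {η : ℝ} (hη : 0 < η) :
    ∃ A, 0 ≤ A ∧ A ^ 2 ≤ ∫ p, ‖p.1 - p.2‖ ^ 2 ∂π +
        2 * t * (Ent (heatFlow ε χ) - Ent (heatFlow (ε + t) μ)) + η ∧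
      CoupledWithin (heatFlow ε χ) θ (r + A + η) := by
  obtain ⟨C, E, hC, hE, hstep⟩ := exists_heatFlow_segment_step hπ hμ hχ ht hε
  set K := ∫ p, ‖p.1 - p.2‖ ^ 2 ∂π with hK
  set ν : ℝ → Measure ℝ² := fun s => heatFlow (ε + t * s) (π.map (segmentPoint s)) with hν
  have hν0 : ν 0 = heatFlow ε χ := by
    have : segmentPoint 0 = Prod.snd := by ext1 p; simp [segmentPoint]
    simp only [hν, this, hπ.2, mul_zero, add_zero]
  have hν1 : ν 1 = heatFlow (ε + t) μ := by
    have : segmentPoint 1 = Prod.fst := by ext1 p; simp [segmentPoint]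
    simp only [hν, this, hπ.1, mul_one]
  obtain ⟨N, hN⟩ := exists_nat_gt (max (C / η) (E / η ^ 2))
  have hN0 : (0 : ℝ) < N := lt_of_le_of_lt (le_max_of_le_left (by positivity)) hN
  have hNC : C ≤ η * N := by
    have := (le_max_left (C / η) _).trans hN.le
    rwa [div_le_iff₀' hη] at this
  have hNE : E ≤ η ^ 2 * N := by
    have := (le_max_right _ (E / η ^ 2)).trans hN.le
    rwa [div_le_iff₀' (by positivity)] at this
  set h : ℝ := (N : ℝ)⁻¹ with hh
  have hh0 : 0 < h := inv_pos.2 hN0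
  have hNh : N * h = 1 := mul_inv_cancel₀ hN0.ne'
  have hh1 : h ≤ 1 := by
    have : 1 ≤ N := by exact_mod_cast hN0
    exact inv_le_one_of_one_le₀ (by exact_mod_cast this)
  have key : ∀ j : ℕ, j ≤ N → ∃ A S : ℝ, 0 ≤ A ∧ 0 ≤ S ∧ A ^ 2 ≤ j * S ∧
      S + 2 * t * h * (Ent (ν 1) - Ent (ν (1 - j * h))) ≤ j * (h ^ 2 * K + C * h ^ 3) ∧
      CoupledWithin (ν (1 - j * h)) θ (r + A + √(j * (E * h ^ 2))) := by
    intro j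
    induction j with
    | zero =>
      intro _
      refine ⟨0, 0, le_rfl, le_rfl, by simp, by simp, ?_⟩
      simpa [hν1] using hstart
    | succ j ih =>
      intro hj
      obtain ⟨A, S, hA, hS, hAS, hS1, hcw⟩ := ih (by omega)
      have hs0 : 0 ≤ 1 - (j + 1 : ℕ) * h := by
        rw [← hNh, ← sub_mul]
        have : ((j + 1 : ℕ) : ℝ) ≤ N := by exact_mod_cast hj
        exact mul_nonneg (by linarith) hh0.le
      obtain ⟨α, hα, hα1, hα2⟩ := hstep (1 - (j + 1 : ℕ) * h) h hs0 hh0 hh1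
      have hsh : 1 - (j + 1 : ℕ) * h + h = 1 - j * h := by push_cast; ring
      rw [hsh] at hα1 hα2
      refine ⟨A + α, S + α ^ 2, by positivity, by positivity, ?_, ?_, ?_⟩
      · have : 2 * (A * α) ≤ S + j * α ^ 2 := by
          refine abs_le_of_sq_le_sq' ?_ (by positivity) |>.2
          have := mul_le_mul_of_nonneg_right hAS (sq_nonneg α)
          nlinarith [sq_nonneg (S - j * α ^ 2)]
        push_cast
        nlinarith
      · simp only [hν] at hS1 ⊢
        push_cast at hα1 ⊢
        linarith
      · refine (hα2 θ _ hθ (by positivity) hcw).mono (Real.sqrt_nonneg _) ?_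
        rw [Real.sqrt_le_left (by positivity)]
        push_cast
        have h1 : √(j * (E * h ^ 2)) ^ 2 = j * (E * h ^ 2) := Real.sq_sqrt (by positivity)
        have h2 : √((j + 1) * (E * h ^ 2)) ^ 2 = (j + 1) * (E * h ^ 2) :=
          Real.sq_sqrt (by positivity)
        have h3 : √(j * (E * h ^ 2)) ≤ √((j + 1) * (E * h ^ 2)) :=
          Real.sqrt_le_sqrt (by gcongr; linarith)
        have h4 := mul_le_mul_of_nonneg_left h3 (by positivity : 0 ≤ r + A + α)
        nlinarith
  obtain ⟨A, S, hA, hS, hAS, hS1, hcw⟩ := key N le_rfl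
  rw [hNh, sub_self, hν0, hν1] at hS1
  rw [hNh, sub_self, hν0] at hcw
  refine ⟨A, hA, ?_, hcw.mono (by positivity) ?_⟩
  · have h1 : N * S + 2 * t * (N * h) * (Ent (heatFlow (ε + t) μ) - Ent (heatFlow ε χ)) ≤
        (N * h) ^ 2 * K + (N * h) ^ 2 * (C * h) := by
      have := mul_le_mul_of_nonneg_left hS1 hN0.le
      linarith
    rw [hNh] at h1
    have h2 : C * h ≤ η := by
      calc C * h ≤ η * N * h := by gcongr
        _ = η := by rw [mul_assoc, hNh, mul_one]
    linarith
  · gcongr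
    rw [Real.sqrt_le_left hη.le]
    calc N * (E * h ^ 2) ≤ N * (η ^ 2 * N * h ^ 2) := by gcongr
      _ = (N * h) ^ 2 * η ^ 2 := by ring
      _ = η ^ 2 := by rw [hNh]; ring

end Chain

section Regularization

lemma integral_snd_norm_sq_prod_stdHeat {Ω : Type*} [MeasurableSpace Ω] {π : Measure Ω}
    [IsProbabilityMeasure π] (a : ℝ) :
    ∫ p : Ω × ℝ², ‖a • p.2‖ ^ 2 ∂(π.prod stdHeat) = a ^ 2 * ∫ w, ‖w‖ ^ 2 ∂stdHeat := by
  rw [integral_norm_smul_sq, integral_fun_snd (μ := π) (ν := stdHeat) (fun w => ‖w‖ ^ 2)]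
  simp

lemma isCoupling_map {Ω Y : Type*} [MeasurableSpace Ω] [MeasurableSpace Y] {P : Measure Ω}
    {X Z : Ω → Y} (hX : Measurable X) (hZ : Measurable Z) :
    IsCoupling (P.map fun p => (X p, Z p)) (P.map X) (P.map Z) :=
  ⟨by rw [Measure.map_map measurable_fst (by fun_prop)]; rfl,
    by rw [Measure.map_map measurable_snd (by fun_prop)]; rfl⟩

lemma IsCoupling.integral_fst_comp {Y : Type*} [MeasurableSpace Y] {μ ν : Measure Y}
    {J : Measure (Y × Y)} (hJ : IsCoupling J μ ν) {f : Y → ℝ} (hf : AEStronglyMeasurable f μ) :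
    ∫ p, f p.1 ∂J = ∫ z, f z ∂μ := by
  obtain ⟨rfl, -⟩ := hJ
  exact (integral_map measurable_fst.aemeasurable hf).symm

lemma memLp_id_heatFlow {μ : Measure ℝ²} [IsProbabilityMeasure μ] (hμ : MemLp id 2 μ) {τ : ℝ}
    (hτ : 0 < τ) : MemLp id 2 (heatFlow τ μ) :=
  memLp_two_id_iff.2 (integrable_norm_sq_heatFlow hτ (memLp_two_id_iff.1 hμ))

/-- Coupling of two heat flows through the same Gaussian variable. -/
lemma isCoupling_heatFlow_heatFlow {μ : Measure ℝ²} [IsProbabilityMeasure μ] {σ τ : ℝ}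
    (hσ : 0 < σ) (hτ : 0 < τ) :
    IsCoupling ((μ.prod stdHeat).map fun p => (p.1 + √σ • p.2, p.1 + √τ • p.2))
      (heatFlow σ μ) (heatFlow τ μ) := by
  rw [← map_add_smul_prod_stdHeat hσ, ← map_add_smul_prod_stdHeat hτ]
  exact isCoupling_map (by fun_prop) (by fun_prop)

lemma integral_coupling_heatFlow_heatFlow {μ : Measure ℝ²} [IsProbabilityMeasure μ] (σ τ : ℝ) :
    ∫ p, ‖p.1 - p.2‖ ^ 2
        ∂((μ.prod stdHeat).map fun p => (p.1 + √σ • p.2, p.1 + √τ • p.2)) =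
      (√σ - √τ) ^ 2 * ∫ w, ‖w‖ ^ 2 ∂stdHeat := by
  rw [integral_map (by fun_prop) (by fun_prop), ← integral_snd_norm_sq_prod_stdHeat (π := μ)]
  simp only [add_sub_add_left_eq_sub, sub_smul]

lemma coupledWithin_heatFlow_heatFlow {μ : Measure ℝ²} [IsProbabilityMeasure μ] {σ τ : ℝ}
    (hσ : 0 < σ) (hτ : 0 < τ) :
    CoupledWithin (heatFlow σ μ) (heatFlow τ μ) (|√σ - √τ| * √(∫ w, ‖w‖ ^ 2 ∂stdHeat)) := by
  refine ⟨_, isCoupling_heatFlow_heatFlow hσ hτ, ?_⟩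
  rw [integral_coupling_heatFlow_heatFlow, mul_pow, sq_abs,
    Real.sq_sqrt (integral_nonneg fun _ => sq_nonneg _)]

lemma CoupledWithin.of_heatFlow {χ θ : Measure ℝ²} [IsProbabilityMeasure χ] (hχ : MemLp id 2 χ)
    (hθ : MemLp id 2 θ) {ε r : ℝ} (hε : 0 < ε) (hr : 0 ≤ r)
    (h : CoupledWithin (heatFlow ε χ) θ r) :
    CoupledWithin χ θ √((r + √ε * √(∫ w, ‖w‖ ^ 2 ∂stdHeat)) ^ 2 + ε * ∫ w, ‖w‖ ^ 2 ∂stdHeat) := by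
  obtain ⟨Q, hQ, hQr⟩ := h
  set Γ := ∫ w, ‖w‖ ^ 2 ∂stdHeat with hΓ
  have hΓ0 : 0 ≤ Γ := integral_nonneg fun _ => sq_nonneg _
  have hfp := isProbabilityMeasure_heatFlow hε χ
  have hJ : IsCoupling ((χ.prod stdHeat).map fun p => (p.1 + √ε • p.2, p.1)) (heatFlow ε χ) χ := by
    have := isCoupling_map (P := χ.prod stdHeat) (X := fun p => p.1 + √ε • p.2) (Z := Prod.fst)
      (by fun_prop) (by fun_prop)
    rwa [map_add_smul_prod_stdHeat hε, Measure.map_fst_prod, measure_univ, one_smul] at this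
  have hJe : ∫ p, ‖p.1 - p.2‖ ^ 2 ∂((χ.prod stdHeat).map fun p => (p.1 + √ε • p.2, p.1)) =
      ε * Γ := by
    rw [integral_map (by fun_prop) (by fun_prop), ← Real.sq_sqrt hε.le, hΓ,
      ← integral_snd_norm_sq_prod_stdHeat (π := χ)]
    simp only [add_sub_cancel_left, Real.sqrt_sq (Real.sqrt_nonneg ε)]
  have hm' := memLp_id_heatFlow hχ hε
  obtain ⟨m, hmm, hmL, hminner, hglue⟩ := exists_condMean_glue hJ hm' hχ
  obtain ⟨Q', hQ', hle⟩ := hglue θ Q hθ hQ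
  have hmε : √(∫ z, ‖m z‖ ^ 2 ∂(heatFlow ε χ)) ≤ √ε * √Γ := by
    have h1 := hminner m hmL
    have h2 := integral_inner_le_sqrt_mul_sqrt (hJ.memLp_fst_comp hmL) (hJ.memLp_sub hm' hχ)
    have h3 : ∫ p, ‖m p.1‖ ^ 2 ∂((χ.prod stdHeat).map fun p => (p.1 + √ε • p.2, p.1)) =
        ∫ z, ‖m z‖ ^ 2 ∂(heatFlow ε χ) :=
      hJ.integral_fst_comp (hmL.1.norm.pow 2)
    rw [← h1, h3, hJe] at h2
    simp only [real_inner_self_eq_norm_sq] at h2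
    rw [← Real.sqrt_mul hε.le]
    have h4 : 0 ≤ ∫ z, ‖m z‖ ^ 2 ∂(heatFlow ε χ) := integral_nonneg fun _ => sq_nonneg _
    have h5 := Real.sq_sqrt h4
    have h6 := Real.sqrt_nonneg (∫ z, ‖m z‖ ^ 2 ∂(heatFlow ε χ))
    by_contra! h7
    have h8 := h7.trans_le' (Real.sqrt_nonneg (ε * Γ))
    nlinarith
  refine ⟨Q', hQ', ?_⟩
  rw [Real.sq_sqrt (by positivity)]
  rw [hJe] at hle
  refine hle.trans ?_
  have : √(∫ p, ‖p.1 - p.2‖ ^ 2 ∂Q) ≤ r := Real.sqrt_le_iff.2 ⟨hr, hQr⟩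
  gcongr

lemma sqrt_add_sub_sqrt_le {t ε : ℝ} (ht : 0 ≤ t) (hε : 0 ≤ ε) : |√(ε + t) - √t| ≤ √ε := by
  have h1 : √t ≤ √(ε + t) := Real.sqrt_le_sqrt (by linarith)
  rw [abs_of_nonneg (sub_nonneg.2 h1), sub_le_iff_le_add, Real.sqrt_le_left (by positivity)]
  nlinarith [Real.sq_sqrt ht, Real.sq_sqrt hε, Real.sqrt_nonneg t, Real.sqrt_nonneg ε]

lemma exists_Ent_heatFlow_le {μ : Measure ℝ²} [IsProbabilityMeasure μ] (hμ : MemLp id 2 μ)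
    {t : ℝ} (ht : 0 < t) :
    ∃ C, ∀ ε, 0 < ε → Ent (heatFlow t μ) ≤ Ent (heatFlow (ε + t) μ) + C * √ε + C * ε := by
  set Γ := ∫ w, ‖w‖ ^ 2 ∂stdHeat with hΓ
  have hΓ0 : 0 ≤ Γ := integral_nonneg fun _ => sq_nonneg _
  have hB := memLp_posteriorMean ht μ
  set b := √(∫ z, ‖posteriorMean t μ z‖ ^ 2 ∂(heatFlow t μ)) with hb
  have hb0 : 0 ≤ b := Real.sqrt_nonneg _
  refine ⟨(2 * t)⁻¹ * (b * √Γ) + (4 * t)⁻¹ * Γ, fun ε hε => ?_⟩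
  have hεt : 0 < ε + t := by positivity
  have hfp := isProbabilityMeasure_heatFlow hεt μ
  have hm := memLp_id_heatFlow hμ ht
  have hm' := memLp_id_heatFlow hμ hεt
  have hJ := isCoupling_heatFlow_heatFlow (μ := μ) ht hεt
  have h1 := Ent_heatFlow_le_of_coupling ht (memLp_two_id_iff.1 hμ)
    (heatFlow_absolutelyContinuous hεt μ)
    (integrable_log_rnDeriv_heatFlow hεt (memLp_two_id_iff.1 hμ)) (memLp_two_id_iff.1 hm') hJ
  have h2 := integral_inner_le_sqrt_mul_sqrt (hJ.memLp_fst_comp hB.neg) (hJ.memLp_sub hm hm')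
  have h3 : ∫ p, ‖(-posteriorMean t μ) p.1‖ ^ 2
      ∂((μ.prod stdHeat).map fun p => (p.1 + √t • p.2, p.1 + √(ε + t) • p.2)) =
      ∫ z, ‖posteriorMean t μ z‖ ^ 2 ∂(heatFlow t μ) := by
    simp only [Pi.neg_apply, norm_neg]
    exact hJ.integral_fst_comp (hB.1.norm.pow 2)
  rw [h3, ← hb] at h2
  rw [integral_coupling_heatFlow_heatFlow] at h1 h2
  simp only [Pi.neg_apply, inner_neg_left, integral_neg] at h2
  have hδ := sqrt_add_sub_sqrt_le ht.le hε.le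
  rw [abs_sub_comm] at hδ
  have h4 : (√t - √(ε + t)) ^ 2 ≤ ε := by
    calc (√t - √(ε + t)) ^ 2 = |√t - √(ε + t)| ^ 2 := (sq_abs _).symm
      _ ≤ √ε ^ 2 := by gcongr
      _ = ε := Real.sq_sqrt hε.le
  have h5 : √((√t - √(ε + t)) ^ 2 * Γ) ≤ √ε * √Γ := by
    rw [← Real.sqrt_mul hε.le]
    exact Real.sqrt_le_sqrt (by gcongr)
  have h6 : -∫ p, inner ℝ (posteriorMean t μ p.1) (p.1 - p.2)
      ∂((μ.prod stdHeat).map fun p => (p.1 + √t • p.2, p.1 + √(ε + t) • p.2)) ≤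
      b * (√ε * √Γ) := h2.trans (by gcongr)
  have h7 : (4 * t)⁻¹ * ((√t - √(ε + t)) ^ 2 * Γ) ≤ (4 * t)⁻¹ * (ε * Γ) := by gcongr
  have h8 := mul_le_mul_of_nonneg_left h6 (by positivity : 0 ≤ (2 * t)⁻¹)
  have h9 : 0 ≤ (2 * t)⁻¹ * (b * √Γ) * ε := by positivity
  have h10 : 0 ≤ (4 * t)⁻¹ * Γ * √ε := by positivity
  linarith

/-- The integrated evolution variational inequality on `ℝ²`, for an arbitrary coupling. -/
lemma le_of_forall_coupledWithin {μ χ : Measure ℝ²} [IsProbabilityMeasure μ]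
    [IsProbabilityMeasure χ] {π : Measure (ℝ² × ℝ²)} (hπ : IsCoupling π μ χ) (hμ : MemLp id 2 μ)
    (hχ : MemLp id 2 χ) (hχac : χ ≪ volume)
    (hχent : Integrable (fun p => Real.log ((χ.rnDeriv volume p).toReal)) χ)
    {t : ℝ} (ht : 0 < t) {T : ℝ}
    (hT : ∀ r, 0 ≤ r → CoupledWithin χ (heatFlow t μ) r → T ≤ r ^ 2) :
    T ≤ ∫ p, ‖p.1 - p.2‖ ^ 2 ∂π + 2 * t * (Ent χ - Ent (heatFlow t μ)) := by
  set Γ := ∫ w, ‖w‖ ^ 2 ∂stdHeat with hΓ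
  have hΓ0 : 0 ≤ Γ := integral_nonneg fun _ => sq_nonneg _
  set b := ∫ p, ‖p.1 - p.2‖ ^ 2 ∂π + 2 * t * (Ent χ - Ent (heatFlow t μ)) with hb
  obtain ⟨C, hC⟩ := exists_Ent_heatFlow_le hμ ht
  have hθ := memLp_id_heatFlow hμ ht
  have key : ∀ g : ℝ, 0 < g → 0 ≤ b + g + 2 * t * (C * g + C * g ^ 2) ∧
      T ≤ (g * √Γ + √(b + g + 2 * t * (C * g + C * g ^ 2)) + g + g * √Γ) ^ 2 + g ^ 2 * Γ := by
    intro g hg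
    have hε : 0 < g ^ 2 := by positivity
    have hgs : √(g ^ 2) = g := Real.sqrt_sq hg.le
    have hδ := sqrt_add_sub_sqrt_le ht.le hε.le
    rw [hgs] at hδ
    obtain ⟨A, hA, hA2, hcw⟩ := exists_chain hπ hμ hχ ht hε hθ (r := g * √Γ) (by positivity)
      ((coupledWithin_heatFlow_heatFlow (by positivity) ht).mono (by positivity)
        (by gcongr)) hg
    have hE1 := Ent_heatFlow_le hε hχac hχent (memLp_two_id_iff.1 hχ)
    have hE2 := hC _ hε
    rw [hgs] at hE2
    have hE3 : 2 * t * (Ent (heatFlow (g ^ 2) χ) - Ent (heatFlow (g ^ 2 + t) μ)) ≤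
        2 * t * (Ent χ - Ent (heatFlow t μ) + (C * g + C * g ^ 2)) := by
      gcongr
      linarith
    have hA3 : A ^ 2 ≤ b + g + 2 * t * (C * g + C * g ^ 2) := by linarith
    refine ⟨(sq_nonneg A).trans hA3, ?_⟩
    have h1 := hT _ (Real.sqrt_nonneg _) (hcw.of_heatFlow hχ hθ hε (by positivity))
    rw [hgs, ← hΓ, Real.sq_sqrt (by positivity)] at h1
    refine h1.trans ?_
    have := Real.le_sqrt_of_sq_le hA3
    gcongr
  have hlim1 : Filter.Tendsto (fun g : ℝ => b + g + 2 * t * (C * g + C * g ^ 2))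
      (nhdsWithin 0 (Set.Ioi 0)) (nhds b) := by
    have : Continuous fun g : ℝ => b + g + 2 * t * (C * g + C * g ^ 2) := by fun_prop
    have := this.tendsto 0
    simp only [mul_zero, add_zero, ne_eq, OfNat.ofNat_ne_zero, not_false_eq_true, zero_pow] at this
    exact this.mono_left nhdsWithin_le_nhds
  have hb0 : 0 ≤ b := ge_of_tendsto hlim1
    (Filter.eventually_of_mem self_mem_nhdsWithin fun g hg => (key g hg).1)
  have hlim2 : Filter.Tendsto (fun g : ℝ =>
      (g * √Γ + √(b + g + 2 * t * (C * g + C * g ^ 2)) + g + g * √Γ) ^ 2 + g ^ 2 * Γ)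
      (nhdsWithin 0 (Set.Ioi 0)) (nhds b) := by
    have : Continuous fun g : ℝ =>
        (g * √Γ + √(b + g + 2 * t * (C * g + C * g ^ 2)) + g + g * √Γ) ^ 2 + g ^ 2 * Γ := by
      fun_prop
    have := this.tendsto 0
    simp only [mul_zero, zero_mul, add_zero, zero_add, ne_eq, OfNat.ofNat_ne_zero,
      not_false_eq_true, zero_pow, Real.sq_sqrt hb0] at this
    exact this.mono_left nhdsWithin_le_nhds
  exact ge_of_tendsto hlim2
    (Filter.eventually_of_mem self_mem_nhdsWithin fun g hg => (key g hg).2)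

end Regularization

section Symmetrization

/-- Replace `y` by `-y` whenever this brings it closer to `x`. -/
noncomputable def alignSign (p : ℝ² × ℝ²) : ℝ² × ℝ² :=
  (p.1, if ‖p.1 - p.2‖ ≤ ‖p.1 + p.2‖ then p.2 else -p.2)

lemma measurable_alignSign : Measurable alignSign := by
  refine measurable_fst.prodMk (Measurable.ite ?_ measurable_snd measurable_snd.neg)
  exact measurableSet_le (by fun_prop) (by fun_prop)

lemma norm_alignSign (p : ℝ² × ℝ²) :
    ‖(alignSign p).1 - (alignSign p).2‖ = min ‖p.1 - p.2‖ ‖p.1 + p.2‖ := by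
  unfold alignSign
  split_ifs with h
  · rw [min_eq_left h]
  · rw [min_eq_right (not_le.1 h).le, sub_neg_eq_add]

lemma exists_coupling_alignSign {μ χ : Measure ℝ²} (hμsym : μ.map (fun x => -x) = μ)
    (hχsym : χ.map (fun x => -x) = χ) {π : Measure (ℝ² × ℝ²)} (hπ : IsCoupling π μ χ) :
    ∃ π' : Measure (ℝ² × ℝ²), IsCoupling π' μ χ ∧
      ∫⁻ p, ENNReal.ofReal (‖p.1 - p.2‖ ^ 2) ∂π' =
        ∫⁻ p, ENNReal.ofReal (min ‖p.1 - p.2‖ ‖p.1 + p.2‖ ^ 2) ∂π := by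
  have hG := measurable_alignSign
  have hGn : Measurable fun p => -alignSign p := hG.neg
  have half : ∀ a : ℝ≥0∞, (2 : ℝ≥0∞)⁻¹ * (a + a) = a := fun a => by
    rw [← two_mul, ← mul_assoc, ENNReal.inv_mul_cancel two_ne_zero ofNat_ne_top, one_mul]
  refine ⟨(2 : ℝ≥0∞)⁻¹ • (π.map alignSign + π.map fun p => -alignSign p), ⟨?_, ?_⟩, ?_⟩
  · rw [Measure.map_smul, Measure.map_add _ _ measurable_fst, Measure.map_map measurable_fst hG,
      Measure.map_map measurable_fst hGn]
    have h1 : π.map (Prod.fst ∘ alignSign) = μ := hπ.1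
    have h2 : π.map (Prod.fst ∘ fun p => -alignSign p) = μ := by
      rw [← hμsym, ← hπ.1, Measure.map_map (by fun_prop) measurable_fst]
      rfl
    rw [h1, h2]
    ext s hs
    rw [Measure.smul_apply, Measure.add_apply, smul_eq_mul, half]
  · ext s hs
    have hi : Measurable (s.indicator (1 : ℝ² → ℝ≥0∞)) := measurable_one.indicator hs
    have hin : Measurable fun x : ℝ² => s.indicator (1 : ℝ² → ℝ≥0∞) (-x) := hi.comp measurable_neg
    have hi2 : Measurable fun p : ℝ² × ℝ² => s.indicator (1 : ℝ² → ℝ≥0∞) p.2 :=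
      hi.comp measurable_snd
    have hiG : Measurable fun p : ℝ² × ℝ² => s.indicator (1 : ℝ² → ℝ≥0∞) (alignSign p).2 :=
      hi.comp (measurable_snd.comp hG)
    have hχs : ∫⁻ p, s.indicator 1 p.2 ∂π = χ s := by
      rw [← hπ.2, ← lintegral_indicator_one hs, lintegral_map hi measurable_snd]
    have hχs' : ∫⁻ p, s.indicator 1 (-p.2) ∂π = χ s := by
      conv_rhs => rw [← hχsym]
      rw [← hπ.2, ← lintegral_indicator_one hs, lintegral_map hi (by fun_prop),
        lintegral_map hin measurable_snd]
    have hsum : ∫⁻ p, s.indicator 1 (alignSign p).2 ∂π +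
        ∫⁻ p, s.indicator 1 (-(alignSign p).2) ∂π = χ s + χ s := by
      calc _ = ∫⁻ p, s.indicator 1 p.2 ∂π + ∫⁻ p, s.indicator 1 (-p.2) ∂π := by
            rw [← lintegral_add_left hiG, ← lintegral_add_left hi2]
            refine lintegral_congr fun p => ?_
            unfold alignSign
            split_ifs
            · rfl
            · simp only [neg_neg]
              rw [add_comm]
        _ = χ s + χ s := by rw [hχs, hχs']
    rw [Measure.map_smul, Measure.map_add _ _ measurable_snd, Measure.map_map measurable_snd hG,
      Measure.map_map measurable_snd hGn, Measure.smul_apply, Measure.add_apply,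
      ← lintegral_indicator_one hs, ← lintegral_indicator_one hs,
      lintegral_map hi (measurable_snd.comp hG), lintegral_map hi (measurable_snd.comp hGn)]
    simp only [Function.comp_apply, Prod.snd_neg, smul_eq_mul]
    rw [hsum, half]
  · have hc : Measurable fun p : ℝ² × ℝ² => ENNReal.ofReal (‖p.1 - p.2‖ ^ 2) := by fun_prop
    have hneg : ∀ p : ℝ² × ℝ², ‖(-p).1 - (-p).2‖ = ‖p.1 - p.2‖ := fun p => by
      rw [Prod.fst_neg, Prod.snd_neg, neg_sub_neg, norm_sub_rev]
    rw [lintegral_smul_measure, lintegral_add_measure, lintegral_map hc hG, lintegral_map hc hGn]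
    simp only [hneg, norm_alignSign, smul_eq_mul, half]

lemma transportCost_min_le {μ χ : Measure ℝ²} {J : Measure (ℝ² × ℝ²)} (hJ : IsCoupling J μ χ) :
    transportCost (fun x y : ℝ² => min ‖x - y‖ ‖x + y‖) μ χ ≤
      ∫⁻ p, ENNReal.ofReal (‖p.1 - p.2‖ ^ 2) ∂J := by
  refine (iInf₂_le J hJ).trans (lintegral_mono fun p => ENNReal.ofReal_le_ofReal ?_)
  have : 0 ≤ min ‖p.1 - p.2‖ ‖p.1 + p.2‖ := by positivity
  gcongr
  exact min_le_left _ _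

lemma IsCoupling.lintegral_eq {μ χ : Measure ℝ²} {J : Measure (ℝ² × ℝ²)} (hJ : IsCoupling J μ χ)
    (hμ : MemLp id 2 μ) (hχ : MemLp id 2 χ) :
    ∫⁻ p, ENNReal.ofReal (‖p.1 - p.2‖ ^ 2) ∂J = ENNReal.ofReal (∫ p, ‖p.1 - p.2‖ ^ 2 ∂J) :=
  (ofReal_integral_eq_lintegral_ofReal
    ((hJ.memLp_sub hμ hχ).integrable_norm_pow two_ne_zero)
    (Filter.Eventually.of_forall fun _ => sq_nonneg _)).symm

lemma toReal_transportCost_le_of_coupledWithin {θ χ : Measure ℝ²} (hθ : MemLp id 2 θ)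
    (hχ : MemLp id 2 χ) {r : ℝ} (h : CoupledWithin χ θ r) :
    (transportCost (fun x y : ℝ² => min ‖x - y‖ ‖x + y‖) θ χ).toReal ≤ r ^ 2 := by
  obtain ⟨Q, hQ, hr⟩ := h
  have hJ : IsCoupling (Q.map Prod.swap) θ χ := by
    constructor
    · rw [Measure.map_map measurable_fst measurable_swap, ← hQ.2]; rfl
    · rw [Measure.map_map measurable_snd measurable_swap, ← hQ.1]; rfl
  have h1 := transportCost_min_le hJ
  rw [hJ.lintegral_eq hθ hχ, integral_map (by fun_prop) (by fun_prop)] at h1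
  refine ENNReal.toReal_le_of_le_ofReal (sq_nonneg r) (h1.trans (ENNReal.ofReal_le_ofReal ?_))
  refine le_trans (le_of_eq ?_) hr
  simp only [Prod.fst_swap, Prod.snd_swap, norm_sub_rev]

lemma transportCost_min_ne_top {μ χ : Measure ℝ²} [IsProbabilityMeasure μ]
    [IsProbabilityMeasure χ] (hμ : MemLp id 2 μ) (hχ : MemLp id 2 χ) :
    transportCost (fun x y : ℝ² => min ‖x - y‖ ‖x + y‖) μ χ ≠ ⊤ := by
  have hJ : IsCoupling (μ.prod χ) μ χ := by
    constructor <;> simp [Measure.map_fst_prod, Measure.map_snd_prod]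
  refine ne_top_of_le_ne_top ?_ (transportCost_min_le hJ)
  rw [hJ.lintegral_eq hμ hχ]
  exact ofReal_ne_top

lemma memLp_id_of_lintegral_lt_top {μ : Measure ℝ²}
    (h : ∫⁻ x, ENNReal.ofReal (‖x‖ ^ 2) ∂μ < ⊤) : MemLp id 2 μ := by
  refine memLp_two_id_iff.2 ⟨by fun_prop, ?_⟩
  rwa [hasFiniteIntegral_iff_ofReal (Filter.Eventually.of_forall fun _ => sq_nonneg _)]

end Symmetrization

/-- the integrated Evolution Variational Inequality for the heat flow on the
cone `C(π)`, written in terms of symmetric lifts to `ℝ²` and the cone Wasserstein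
distance `W_c` with cost `min (|x-y|, |x+y|)`. -/
theorem stmt5 (μ χ : Measure (EuclideanSpace ℝ (Fin 2)))
    (hμ : IsProbabilityMeasure μ) (hχ : IsProbabilityMeasure χ)
    (hμm : ∫⁻ x, ENNReal.ofReal (‖x‖ ^ 2) ∂μ < ⊤)
    (hχm : ∫⁻ x, ENNReal.ofReal (‖x‖ ^ 2) ∂χ < ⊤)
    (hμsym : μ.map (fun x => -x) = μ) (hχsym : χ.map (fun x => -x) = χ)
    (hχac : χ ≪ (volume : Measure (EuclideanSpace ℝ (Fin 2))))
    (hχent : Integrable (fun p => Real.log ((χ.rnDeriv volume p).toReal)) χ) :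
    ∀ t : ℝ, 0 ≤ t →
      2⁻¹ * W2 (fun x y => min ‖x - y‖ ‖x + y‖) (heatFlow t μ) χ ^ 2 -
        2⁻¹ * W2 (fun x y => min ‖x - y‖ ‖x + y‖) μ χ ^ 2 ≤
      t * (Ent χ - Ent (heatFlow t μ)) := by
  intro t ht
  rcases ht.eq_or_lt with rfl | ht
  · simp [heatFlow]
  have hμ2 := memLp_id_of_lintegral_lt_top hμm
  have hχ2 := memLp_id_of_lintegral_lt_top hχm
  simp only [W2, Real.sq_sqrt ENNReal.toReal_nonneg]
  set T := (transportCost (fun x y : EuclideanSpace ℝ (Fin 2) => min ‖x - y‖ ‖x + y‖)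
    (heatFlow t μ) χ).toReal with hTdef
  have hfin := transportCost_min_ne_top hμ2 hχ2
  have key : ENNReal.ofReal (T - 2 * t * (Ent χ - Ent (heatFlow t μ))) ≤
      transportCost (fun x y : EuclideanSpace ℝ (Fin 2) => min ‖x - y‖ ‖x + y‖) μ χ := by
    refine le_iInf₂ fun π hπ => ?_
    obtain ⟨π', hπ', hcost⟩ := exists_coupling_alignSign hμsym hχsym hπ
    rw [← hcost, hπ'.lintegral_eq hμ2 hχ2]
    refine ENNReal.ofReal_le_ofReal ?_
    have := le_of_forall_coupledWithin hπ' hμ2 hχ2 hχac hχent ht (T := T) fun r _ hr =>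
      toReal_transportCost_le_of_coupledWithin (memLp_id_heatFlow hμ2 ht) hχ2 hr
    linarith
  rw [ENNReal.ofReal_le_iff_le_toReal hfin] at key
  linarith
end
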